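/- arXiv:1402.2888 — 2 statements merged into one kernel-verified Lean document; each statement's English description precedes it below -/
import Mathlib

section
/- Suppose u is real analytic and v is harmonic on a domain Ω ⊆ ℝ^n (n ≥ 2), v not identically zero, and Z(v) ⊆ Z(u). Then there exists a real analytic function f on Ω such that u = v·f on Ω. -/
/-- `f` is harmonic on `s`: it is `C²` there and its Laplacian vanishes. -/
def IsHarmonicOn {n : ℕ} (f : (Fin n → ℝ) → ℝ) (s : Set (Fin n → ℝ)) : Prop :=
  ContDiffOn ℝ 2 f s ∧
    ∀ x ∈ s, ∑ i : Fin n, iteratedFDeriv ℝ 2 f x (fun _ => Pi.single i 1) = 0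

section MeanValue

open MeasureTheory Metric Set Filter Topology

set_option linter.unusedSectionVars false

variable {E : Type} [NormedAddCommGroup E] [NormedSpace ℝ E] [FiniteDimensional ℝ E]
  [MeasurableSpace E] [BorelSpace E] {μ : Measure E} [μ.IsAddHaarMeasure]

/-- A smooth averaging kernel of total mass one supported in the closed unit ball. -/
structure IsAveragingKernel (μ : Measure E) (φ : E → ℝ) : Prop where
  contDiff : ContDiff ℝ (⊤ : ℕ∞) φ
  eq_zero : ∀ y, 1 < ‖y‖ → φ y = 0
  integral_eq_one : ∫ y, φ y ∂μ = 1

/-- `f` is continuous on `U` and equals its `φ`-averages over all closed balls inside `U`. -/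
structure HasMeanValue (μ : Measure E) (φ : E → ℝ) {F : Type} [NormedAddCommGroup F]
    [NormedSpace ℝ F] (f : E → F) (U : Set E) : Prop where
  continuousOn : ContinuousOn f U
  average : ∀ x r, 0 < r → closedBall x r ⊆ U → ∫ y, φ y • f (x + r • y) ∂μ = f x

variable {F : Type} [NormedAddCommGroup F] [NormedSpace ℝ F] {φ : E → ℝ} {f : E → F} {U : Set E}

lemma add_smul_mem_closedBall {x y : E} {r : ℝ} (hr : 0 ≤ r) (hy : ‖y‖ ≤ 1) :
    x + r • y ∈ closedBall x r := by
  rw [mem_closedBall, dist_eq_norm, add_sub_cancel_left, norm_smul, Real.norm_of_nonneg hr]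
  nlinarith

lemma IsCompact.exists_closedBall_add_subset {x : E} {r : ℝ} (hr : 0 ≤ r) (hU : IsOpen U)
    (h : closedBall x r ⊆ U) : ∃ ε > 0, closedBall x (ε + r) ⊆ U := by
  obtain ⟨ε, hε, h'⟩ := (isCompact_closedBall x r).exists_cthickening_subset_open hU h
  exact ⟨ε, hε, by rwa [cthickening_closedBall hε.le hr] at h'⟩

lemma integrable_smul_of_eq_zero (hφ : Continuous φ) {R : ℝ} (h0 : ∀ y, R < ‖y‖ → φ y = 0)
    {g : E → F} (hg : ContinuousOn g (closedBall 0 R)) :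
    Integrable (fun y => φ y • g y) μ := by
  rw [← integrableOn_iff_integrable_of_support_subset (s := closedBall 0 R)]
  · exact (hφ.continuousOn.smul hg).integrableOn_compact (isCompact_closedBall 0 R)
  · intro y hy
    by_contra hy'
    exact hy (by simp [h0 y (by simpa using hy')])

lemma continuousOn_comp_add_smul {G : Type} [TopologicalSpace G] {g : E → G}
    (hg : ContinuousOn g U) {x : E} {r : ℝ}
    (hr : 0 ≤ r) (h : closedBall x r ⊆ U) :
    ContinuousOn (fun y => g (x + r • y)) (closedBall 0 1) :=
  hg.comp (by fun_prop) fun _ hy =>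
    h (add_smul_mem_closedBall hr (by simpa using hy))

lemma IsAveragingKernel.hasCompactSupport (hφ : IsAveragingKernel μ φ) : HasCompactSupport φ :=
  HasCompactSupport.intro (isCompact_closedBall 0 1) fun y hy => hφ.eq_zero y (by simpa using hy)

lemma HasMeanValue.contDiffAt [CompleteSpace F] (hφ : IsAveragingKernel μ φ)
    (hf : HasMeanValue μ φ f U) (hU : IsOpen U) {x : E} (hx : x ∈ U) :
    ContDiffAt ℝ (⊤ : ℕ∞) f x := by
  obtain ⟨R, hR, hRU⟩ := nhds_basis_closedBall.mem_iff.1 (hU.mem_nhds hx)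
  set r := R / 2 with hr
  have hr0 : 0 < r := by positivity
  set g : E → F := indicator (closedBall x R) f
  set K : E → ℝ := fun t => |((-r) ^ Module.finrank ℝ E)⁻¹| * φ ((-r)⁻¹ • t)
  have hKs : ContDiff ℝ (⊤ : ℕ∞) K :=
    contDiff_const.mul (hφ.contDiff.comp (contDiff_const_smul _))
  have hKc : HasCompactSupport K := by
    have : HasCompactSupport fun t => φ ((-r)⁻¹ • t) :=
      hφ.hasCompactSupport.comp_smul (inv_ne_zero (neg_ne_zero.2 hr0.ne'))
    exact this.mul_left
  have hg : LocallyIntegrable g μ := by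
    refine Integrable.locallyIntegrable ?_
    rw [integrable_indicator_iff measurableSet_closedBall]
    exact (hf.continuousOn.mono hRU).integrableOn_compact (isCompact_closedBall _ _)
  have hsm := hKc.contDiff_convolution_left (ContinuousLinearMap.lsmul ℝ ℝ) hKs hg
  refine hsm.contDiffAt.congr_of_eventuallyEq ?_
  filter_upwards [closedBall_mem_nhds x hr0] with z hz
  have hzsub : closedBall z r ⊆ closedBall x R :=
    closedBall_subset_closedBall' (by have := mem_closedBall.1 hz; linarith)
  rw [← hf.average z r hr0 (hzsub.trans hRU), convolution_def]
  have := Measure.integral_comp_smul μ (fun t => φ ((-r)⁻¹ • t) • g (z - t)) (-r)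
  have hne : -r ≠ 0 := neg_ne_zero.2 hr0.ne'
  simp only [smul_smul, inv_mul_cancel₀ hne, one_smul] at this
  have h2 : ∀ y, φ y • g (z - -r • y) = φ y • f (z + r • y) := by
    intro y
    by_cases hy : ‖y‖ ≤ 1
    · rw [neg_smul, sub_neg_eq_add]
      congr 1
      exact indicator_of_mem (hzsub (add_smul_mem_closedBall hr0.le hy)) _
    · simp [hφ.eq_zero y (not_le.1 hy)]
  simp only [h2] at this
  rw [this, ← integral_smul]
  simp [K, smul_smul]

lemma HasMeanValue.norm_fderiv_le (hφ : IsAveragingKernel μ φ) :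
    ∃ C : ℝ, 0 < C ∧ ∀ {F : Type} [NormedAddCommGroup F] [NormedSpace ℝ F] {f : E → F} {U : Set E}
      (_ : HasMeanValue μ φ f U) {x : E} {δ M : ℝ} (_ : 0 < δ) (_ : closedBall x δ ⊆ U)
      (_ : ∀ z ∈ closedBall x δ, ‖f z‖ ≤ M), ‖fderiv ℝ f x‖ ≤ C / δ * M := by
  obtain ⟨L, hL⟩ := hφ.contDiff.lipschitzWith_of_hasCompactSupport hφ.hasCompactSupport (by simp)
  set B := μ.real (closedBall (0 : E) 2) with hB
  refine ⟨4 * L * B + 1, by positivity, ?_⟩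
  intro F _ _ f U hf x δ M hδ hsub hM
  have hM0 : 0 ≤ M := (norm_nonneg _).trans (hM x (mem_closedBall_self hδ.le))
  refine norm_fderiv_le_of_lip' ℝ (by positivity) ?_
  set r := δ / 4 with hr
  have hr0 : 0 < r := by positivity
  filter_upwards [closedBall_mem_nhds x hr0] with z hz
  have hz' : ‖z - x‖ ≤ r := by simpa [dist_eq_norm] using hz
  have hzs : closedBall z r ⊆ closedBall x δ :=
    closedBall_subset_closedBall' (by have := mem_closedBall.1 hz; linarith)
  have hxs : closedBall x (2 * r) ⊆ closedBall x δ := closedBall_subset_closedBall (by linarith)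
  set h := r⁻¹ • (z - x) with hh
  have hh1 : ‖h‖ ≤ 1 := by
    rw [hh, norm_smul, Real.norm_of_nonneg (by positivity), inv_mul_le_iff₀ hr0]; simpa using hz'
  have e1 : f z = ∫ y, φ (y - h) • f (x + r • y) ∂μ := by
    rw [← hf.average z r hr0 (hzs.trans hsub),
      ← integral_sub_right_eq_self (fun y => φ y • f (z + r • y)) h]
    congr with y
    rw [smul_sub, hh, smul_smul, mul_inv_cancel₀ hr0.ne', one_smul]
    congr 2
    abel
  have e2 := hf.average x r hr0 ((closedBall_subset_closedBall (by linarith)).trans hsub)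
  have hmem : ∀ y : E, ‖y‖ ≤ 2 → x + r • y ∈ closedBall x δ := by
    intro y hy
    refine hxs ?_
    rw [mem_closedBall, dist_eq_norm, add_sub_cancel_left, norm_smul, Real.norm_of_nonneg hr0.le]
    nlinarith
  have hc : ContinuousOn (fun y => f (x + r • y)) (closedBall 0 2) :=
    hf.continuousOn.comp (by fun_prop) fun y hy => hsub (hmem y (by simpa using hy))
  have z1 : ∀ y, 2 < ‖y‖ → φ (y - h) = 0 := fun y hy => hφ.eq_zero _ (by
    have := norm_sub_norm_le y h
    linarith)
  have z2 : ∀ y, 2 < ‖y‖ → φ y = 0 := fun y hy => hφ.eq_zero _ (by linarith)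
  have hφc := hφ.contDiff.continuous
  rw [e1, ← e2, ← integral_sub (integrable_smul_of_eq_zero (φ := fun y => φ (y - h))
    (by fun_prop) z1 hc) (integrable_smul_of_eq_zero hφc z2 hc)]
  refine (norm_integral_le_of_norm_le (g := indicator (closedBall 0 2) fun _ => L * ‖h‖ * M)
    ?_ (Eventually.of_forall fun y => ?_)).trans ?_
  · rw [integrable_indicator_iff measurableSet_closedBall]
    exact continuousOn_const.integrableOn_compact (isCompact_closedBall _ _)
  · by_cases hy : ‖y‖ ≤ 2
    · rw [indicator_of_mem (by simpa using hy), ← sub_smul, norm_smul]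
      have := hL.dist_le_mul (y - h) y
      rw [dist_eq_norm, dist_eq_norm, sub_sub_cancel_left, norm_neg] at this
      exact mul_le_mul this (hM _ (hmem y hy)) (norm_nonneg _) (by positivity)
    · rw [not_le] at hy
      rw [indicator_of_notMem (by simpa using hy), z1 y hy, z2 y hy]
      simp
  · rw [integral_indicator measurableSet_closedBall, setIntegral_const, ← hB, smul_eq_mul, hh,
      norm_smul, Real.norm_of_nonneg (by positivity), hr]
    have : B * (L * ((δ / 4)⁻¹ * ‖z - x‖) * M) = (4 * L * B) / δ * M * ‖z - x‖ := by
      field_simp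
    rw [this]
    gcongr
    linarith

lemma HasMeanValue.fderiv [CompleteSpace F] (hφ : IsAveragingKernel μ φ)
    (hf : HasMeanValue μ φ f U) (hU : IsOpen U) : HasMeanValue μ φ (fderiv ℝ f) U := by
  have hsm : ∀ x ∈ U, ContDiffAt ℝ (⊤ : ℕ∞) f x := fun x hx => hf.contDiffAt hφ hU hx
  have hcont : ContinuousOn (_root_.fderiv ℝ f) U := fun x hx =>
    (((hsm x hx).fderiv_right (m := 0) (by simp)).continuousAt).continuousWithinAt
  refine ⟨hcont, fun x r hr hsub => ?_⟩
  obtain ⟨ε, hε, hεU⟩ := IsCompact.exists_closedBall_add_subset hr.le hU hsub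
  have hφc := hφ.contDiff.continuous
  have hball : ∀ z ∈ ball x ε, closedBall z r ⊆ closedBall x (ε + r) := fun z hz =>
    closedBall_subset_closedBall' (by have := mem_ball.1 hz; linarith)
  obtain ⟨M, hM⟩ := (isCompact_closedBall x (ε + r)).exists_bound_of_continuousOn
    (hcont.mono hεU)
  have key := hasFDerivAt_integral_of_dominated_of_fderiv_le (𝕜 := ℝ) (μ := μ)
    (F := fun z y => φ y • f (z + r • y)) (F' := fun z y => φ y • _root_.fderiv ℝ f (z + r • y))
    (x₀ := x) (bound := fun y => |φ y| * M) (s := ball x ε) (ball_mem_nhds x hε)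
    ?_ ?_ ?_ ?_ ?_ ?_
  · have heq : (fun z => ∫ y, φ y • f (z + r • y) ∂μ) =ᶠ[𝓝 x] f := by
      filter_upwards [ball_mem_nhds x hε] with z hz
      exact hf.average z r hr ((hball z hz).trans hεU)
    rw [← heq.fderiv_eq, key.fderiv]
  · filter_upwards [ball_mem_nhds x hε] with z hz
    exact (integrable_smul_of_eq_zero hφc hφ.eq_zero
      (continuousOn_comp_add_smul hf.continuousOn hr.le ((hball z hz).trans hεU))).1
  · exact integrable_smul_of_eq_zero hφc hφ.eq_zero
      (continuousOn_comp_add_smul hf.continuousOn hr.le hsub)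
  · exact (integrable_smul_of_eq_zero hφc hφ.eq_zero
      (continuousOn_comp_add_smul hcont hr.le hsub)).1
  · refine Eventually.of_forall fun y z hz => ?_
    rw [norm_smul, Real.norm_eq_abs]
    by_cases hy : ‖y‖ ≤ 1
    · gcongr
      exact hM _ (hball z hz (add_smul_mem_closedBall hr.le hy))
    · simp [hφ.eq_zero y (not_le.1 hy)]
  · exact (hφc.abs.integrable_of_hasCompactSupport hφ.hasCompactSupport.norm).mul_const M
  · refine Eventually.of_forall fun y z hz => ?_
    by_cases hy : ‖y‖ ≤ 1
    · have h1 : DifferentiableAt ℝ f (z + r • y) :=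
        (hsm _ (hεU (hball z hz (add_smul_mem_closedBall hr.le hy)))).differentiableAt (by simp)
      have h2 : HasFDerivAt (fun z => f (z + r • y)) (_root_.fderiv ℝ f (z + r • y)) z := by
        simpa [Function.comp_def] using h1.hasFDerivAt.comp z ((hasFDerivAt_id z).add_const (r • y))
      exact h2.const_smul (φ y)
    · simpa [hφ.eq_zero y (not_le.1 hy)] using hasFDerivAt_const (0 : F) z

lemma HasMeanValue.norm_iteratedFDeriv_le (hφ : IsAveragingKernel μ φ) :
    ∃ C : ℝ, 0 < C ∧ ∀ (k : ℕ) {F : Type} [NormedAddCommGroup F] [NormedSpace ℝ F]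
      [CompleteSpace F] {f : E → F} {U : Set E} (_ : IsOpen U)
      (_ : HasMeanValue μ φ f U) {x : E} {δ M : ℝ} (_ : 0 < δ) (_ : closedBall x (k * δ) ⊆ U)
      (_ : ∀ z ∈ closedBall x (k * δ), ‖f z‖ ≤ M), ‖iteratedFDeriv ℝ k f x‖ ≤ (C / δ) ^ k * M := by
  obtain ⟨C, hC, h⟩ := HasMeanValue.norm_fderiv_le hφ
  refine ⟨C, hC, fun k => ?_⟩
  induction k with
  | zero =>
    intro F _ _ _ f U hU hf x δ M hδ hsub hM
    simpa using hM x (by simp)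
  | succ k ih =>
    intro F _ _ _ f U hU hf x δ M hδ hsub hM
    rw [← norm_iteratedFDeriv_fderiv, pow_succ, mul_assoc]
    have hsub' : closedBall x (k * δ) ⊆ closedBall x ((k + 1 : ℕ) * δ) :=
      closedBall_subset_closedBall (by push_cast; nlinarith)
    refine ih hU (hf.fderiv hφ hU) hδ (hsub'.trans hsub) fun z hz => ?_
    have hzsub : closedBall z δ ⊆ closedBall x ((k + 1 : ℕ) * δ) :=
      closedBall_subset_closedBall' (by have := mem_closedBall.1 hz; push_cast; linarith)
    exact h hf hδ (hzsub.trans hsub) fun w hw => hM w (hzsub hw)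

/-- A smooth function whose iterated derivatives grow at most like `A ^ k * k!` is analytic. -/
lemma analyticAt_of_norm_iteratedFDeriv_le [CompleteSpace F] {x : E} {R A M : ℝ} (hR : 0 < R)
    (hA : 0 < A)
    (hf : ∀ z ∈ closedBall x R, ContDiffAt ℝ (⊤ : ℕ∞) f z)
    (hb : ∀ k : ℕ, ∀ z ∈ closedBall x R,
      ‖iteratedFDeriv ℝ k f z‖ ≤ M * A ^ k * (k.factorial : ℝ)) :
    AnalyticAt ℝ f x := by
  have hM : 0 ≤ M := by
    have := (norm_nonneg _).trans (hb 0 x (mem_closedBall_self hR.le))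
    simpa using this
  set p : FormalMultilinearSeries ℝ E F := fun k => (k.factorial : ℝ)⁻¹ • iteratedFDeriv ℝ k f x
  have hp : ∀ k, ‖p k‖ ≤ M * A ^ k := by
    intro k
    have := hb k x (mem_closedBall_self hR.le)
    simp only [p, norm_smul, norm_inv, Real.norm_natCast]
    rw [inv_mul_le_iff₀ (by positivity)]
    linarith
  set s : ℝ := min R (1 / (2 * A)) with hs
  have hs0 : 0 < s := by positivity
  have hsA : A * s ≤ 1 / 2 := by
    have : s ≤ 1 / (2 * A) := min_le_right _ _
    calc A * s ≤ A * (1 / (2 * A)) := by gcongr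
      _ = 1 / 2 := by field_simp
  refine HasFPowerSeriesAt.analyticAt (p := p)
    ⟨ENNReal.ofReal s, ?_, by simpa using hs0, fun {y} hy => ?_⟩
  · refine p.le_radius_of_bound (r := s.toNNReal) M fun k => ?_
    rw [Real.coe_toNNReal _ hs0.le]
    calc ‖p k‖ * s ^ k ≤ M * A ^ k * s ^ k := by gcongr; exact hp k
      _ = M * (A * s) ^ k := by rw [mul_pow]; ring
      _ ≤ M * 1 := by
        gcongr
        exact pow_le_one₀ (by positivity) (by linarith)
      _ = M := mul_one _
  · have hys : ‖y‖ < s := by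
      rw [Metric.eball_ofReal] at hy
      simpa using hy
    have hAy : A * ‖y‖ ≤ 1 / 2 := (mul_le_mul_of_nonneg_left hys.le hA.le).trans hsA
    have hmem : ∀ t ∈ Icc (0 : ℝ) 1, x + t • y ∈ closedBall x R := by
      intro t ht
      rw [mem_closedBall, dist_eq_norm, add_sub_cancel_left, norm_smul, Real.norm_of_nonneg ht.1]
      have : ‖y‖ ≤ R := hys.le.trans (min_le_left _ _)
      nlinarith [ht.2, norm_nonneg y]
    have hsum : Summable fun k => p k fun _ => y := by
      refine Summable.of_norm_bounded (g := fun k => M * (1 / 2 : ℝ) ^ k)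
        (summable_geometric_two.mul_left M) fun k => ?_
      calc ‖p k fun _ => y‖ ≤ ‖p k‖ * ‖y‖ ^ k := by
            simpa using (p k).le_opNorm fun _ => y
        _ ≤ M * A ^ k * ‖y‖ ^ k := by gcongr; exact hp k
        _ = M * (A * ‖y‖) ^ k := by rw [mul_pow]; ring
        _ ≤ M * (1 / 2) ^ k := by gcongr
    refine (hsum.hasSum_iff_tendsto_nat).2 ?_
    rw [← tendsto_add_atTop_iff_nat 1, ← tendsto_sub_nhds_zero_iff]
    refine squeeze_zero_norm (a := fun k : ℕ => M * ((k + 1 : ℕ) * (1 / 2 : ℝ) ^ (k + 1))) ?_ ?_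
    · intro k
      have hT := map_add_eq_sum_add_integral_iteratedFDeriv (f := f) (x := x) (y := y) (n := k)
        fun t ht => (hf _ (hmem t ht)).of_le (by exact_mod_cast le_top)
      have : ∑ i ∈ Finset.range (k + 1), (p i fun _ => y) - f (x + y) =
          -((k.factorial : ℝ)⁻¹ • ∫ t in (0:ℝ)..1,
            (1 - t) ^ k • iteratedFDeriv ℝ (k + 1) f (x + t • y) (fun _ ↦ y)) := by
        rw [hT]
        simp [p]
      rw [this, norm_neg, norm_smul, norm_inv, Real.norm_natCast, inv_mul_le_iff₀ (by positivity)]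
      have hbd := intervalIntegral.norm_integral_le_of_norm_le_const (a := (0:ℝ)) (b := 1)
        (f := fun t : ℝ => (1 - t) ^ k • iteratedFDeriv ℝ (k + 1) f (x + t • y) (fun _ ↦ y))
        (C := M * A ^ (k + 1) * ((k + 1).factorial : ℝ) * ‖y‖ ^ (k + 1)) ?_
      · refine hbd.trans ?_
        rw [sub_zero, abs_one, mul_one, Nat.factorial_succ]
        push_cast
        calc M * A ^ (k + 1) * ((k + 1) * (k.factorial : ℝ)) * ‖y‖ ^ (k + 1)
            = (k.factorial : ℝ) * (M * ((k + 1) * (A * ‖y‖) ^ (k + 1))) := by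
              rw [mul_pow]; ring
          _ ≤ _ := by gcongr
      · intro t ht
        rw [uIoc_of_le zero_le_one] at ht
        have hk := hb (k + 1) _ (hmem t ⟨ht.1.le, ht.2⟩)
        have h1 : ‖(1 - t) ^ k‖ ≤ 1 := by
          rw [norm_pow]
          refine pow_le_one₀ (norm_nonneg _) ?_
          rw [Real.norm_eq_abs, abs_le]
          constructor <;> linarith [ht.1, ht.2]
        rw [norm_smul]
        calc _ ≤ 1 * (‖iteratedFDeriv ℝ (k + 1) f (x + t • y)‖ * ‖y‖ ^ (k + 1)) := by
              gcongr
              simpa using (iteratedFDeriv ℝ (k + 1) f (x + t • y)).le_opNorm fun _ => y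
          _ ≤ _ := by rw [one_mul]; gcongr
    · have := (tendsto_self_mul_const_pow_of_lt_one (r := (1 / 2 : ℝ)) (by norm_num)
        (by norm_num))
      have := ((tendsto_add_atTop_iff_nat 1).2 this).const_mul M
      simpa using this

/-- Functions with the mean value property are analytic. -/
lemma HasMeanValue.analyticAt [CompleteSpace F] (hφ : IsAveragingKernel μ φ)
    (hf : HasMeanValue μ φ f U) (hU : IsOpen U) {x : E} (hx : x ∈ U) : AnalyticAt ℝ f x := by
  obtain ⟨R, hR, hRU⟩ := nhds_basis_closedBall.mem_iff.1 (hU.mem_nhds hx)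
  obtain ⟨C, hC, h⟩ := HasMeanValue.norm_iteratedFDeriv_le hφ
  obtain ⟨M, hM⟩ := (isCompact_closedBall x R).exists_bound_of_continuousOn
    (hf.continuousOn.mono hRU)
  have hhalf : closedBall x (R / 2) ⊆ U :=
    (closedBall_subset_closedBall (by linarith)).trans hRU
  have hM0 : 0 ≤ M := (norm_nonneg _).trans (hM x (mem_closedBall_self hR.le))
  refine analyticAt_of_norm_iteratedFDeriv_le (R := R / 2) (A := 2 * C / R * Real.exp 1) (M := M)
    (by positivity) (by positivity) (fun z hz => hf.contDiffAt hφ hU (hhalf hz)) fun k z hz => ?_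
  rcases Nat.eq_zero_or_pos k with rfl | hk
  · simpa using hM z (closedBall_subset_closedBall (by linarith) hz)
  have hk0 : (0 : ℝ) < k := by exact_mod_cast hk
  have hsub : closedBall z (k * (R / (2 * k))) ⊆ closedBall x R := by
    refine closedBall_subset_closedBall' ?_
    have := mem_closedBall.1 hz
    have e : (k : ℝ) * (R / (2 * k)) = R / 2 := by field_simp
    rw [e]
    linarith
  refine (h k hU hf (δ := R / (2 * k)) (by positivity) (hsub.trans hRU)
    fun w hw => hM w (hsub hw)).trans ?_
  have he := Real.pow_div_factorial_le_exp k hk0.le k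
  rw [div_le_iff₀ (by positivity)] at he
  calc (C / (R / (2 * k))) ^ k * M = M * (2 * C / R) ^ k * (k : ℝ) ^ k := by
        rw [mul_comm, mul_assoc, ← mul_pow]
        congr 2
        field_simp
    _ ≤ M * (2 * C / R) ^ k * (Real.exp k * k.factorial) := by gcongr
    _ = M * (2 * C / R * Real.exp 1) ^ k * k.factorial := by
        rw [mul_pow, ← Real.exp_nat_mul, mul_one]
        ring

end MeanValue

section Harmonic

open MeasureTheory Metric Set Filter Topology

variable {n : ℕ}

/-- An (unnormalized) radial bump: a smooth function of `∑ yᵢ²` vanishing off the unit ball. -/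
noncomputable def radialBump (y : Fin n → ℝ) : ℝ := expNegInvGlue (1 - ∑ i, y i ^ 2)

/-- A radial function whose partial derivatives are `2 yᵢ` times the radial bump. -/
noncomputable def radialPotential (y : Fin n → ℝ) : ℝ :=
  ∫ t in (1 : ℝ)..(∑ i, y i ^ 2), expNegInvGlue (1 - t)

lemma one_lt_sum_sq {y : Fin n → ℝ} (hy : 1 < ‖y‖) : 1 < ∑ i, y i ^ 2 := by
  by_contra! h
  refine absurd hy (not_lt.2 ((pi_norm_le_iff_of_nonneg zero_le_one).2 fun i => ?_))
  have h1 : y i ^ 2 ≤ 1 :=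
    (Finset.single_le_sum (f := fun i => y i ^ 2) (fun j _ => sq_nonneg (y j))
      (Finset.mem_univ i)).trans h
  rwa [sq_le_one_iff_abs_le_one] at h1

lemma contDiff_radialBump : ContDiff ℝ (⊤ : ℕ∞) (radialBump (n := n)) := by
  unfold radialBump
  exact expNegInvGlue.contDiff.comp (by fun_prop)

lemma radialBump_eq_zero (y : Fin n → ℝ) (hy : 1 < ‖y‖) : radialBump y = 0 :=
  expNegInvGlue.zero_of_nonpos (by linarith [one_lt_sum_sq hy])

lemma radialPotential_eq_zero (y : Fin n → ℝ) (hy : 1 < ‖y‖) : radialPotential y = 0 := by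
  refine intervalIntegral.integral_zero_ae (Eventually.of_forall fun t ht => ?_)
  rw [uIoc_of_le (one_lt_sum_sq hy).le] at ht
  exact expNegInvGlue.zero_of_nonpos (by linarith [ht.1])

lemma hasFDerivAt_radialPotential (y : Fin n → ℝ) :
    HasFDerivAt radialPotential
      (radialBump y • ∑ i, (2 * y i) • ContinuousLinearMap.proj (R := ℝ) (φ := fun _ => ℝ) i)
      y := by
  have hc : Continuous fun t : ℝ => expNegInvGlue (1 - t) :=
    (expNegInvGlue.contDiff (n := 0)).continuous.comp (by fun_prop)
  have h1 := (hc.integral_hasStrictDerivAt 1 (∑ i, y i ^ 2)).hasDerivAt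
  have h2 : HasFDerivAt (fun y : Fin n → ℝ => ∑ i, y i ^ 2)
      (∑ i, (2 * y i) • ContinuousLinearMap.proj (R := ℝ) (φ := fun _ => ℝ) i) y := by
    refine HasFDerivAt.fun_sum fun i _ => ?_
    simpa using (hasFDerivAt_apply (𝕜 := ℝ) i y).pow 2
  exact h1.comp_hasFDerivAt y h2

lemma fderiv_radialPotential_single (y : Fin n → ℝ) (i : Fin n) :
    fderiv ℝ radialPotential y (Pi.single i 1) = 2 * y i * radialBump y := by
  rw [(hasFDerivAt_radialPotential y).fderiv]
  simp [Pi.single_apply, mul_comm]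

lemma continuous_radialPotential : Continuous (radialPotential (n := n)) :=
  continuous_iff_continuousAt.2 fun y => (hasFDerivAt_radialPotential y).continuousAt

lemma radialBump_integral_pos : 0 < ∫ y : Fin n → ℝ, radialBump y := by
  have hc : HasCompactSupport (radialBump (n := n)) :=
    HasCompactSupport.intro (isCompact_closedBall 0 1) fun y hy =>
      radialBump_eq_zero y (by simpa using hy)
  refine contDiff_radialBump.continuous.integral_pos_of_hasCompactSupport_nonneg_nonzero hc
    (fun y => expNegInvGlue.nonneg _) (x := 0) ?_
  exact (expNegInvGlue.pos_of_pos (by simp)).ne'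

lemma isAveragingKernel_radialBump : IsAveragingKernel (volume : Measure (Fin n → ℝ))
    fun y => (∫ z : Fin n → ℝ, radialBump z)⁻¹ * radialBump y where
  contDiff := contDiff_const.mul contDiff_radialBump
  eq_zero y hy := by simp [radialBump_eq_zero y hy]
  integral_eq_one := by
    rw [integral_const_mul, inv_mul_cancel₀ radialBump_integral_pos.ne']

variable {v : (Fin n → ℝ) → ℝ} {s : Set (Fin n → ℝ)}

/-- Integration by parts: the flux of a harmonic function against a radial bump vanishes. -/
lemma IsHarmonicOn.integral_radialBump_mul_fderiv (hv : IsHarmonicOn v s) (hs : IsOpen s)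
    {x : Fin n → ℝ} {r : ℝ} (hr : 0 ≤ r) (hsub : closedBall x r ⊆ s) :
    ∫ y, radialBump y * fderiv ℝ v (x + r • y) y = 0 := by
  have hat : ∀ z ∈ s, ContDiffAt ℝ 2 v z := fun z hz => hv.1.contDiffAt (hs.mem_nhds hz)
  have hD : ∀ z ∈ s, DifferentiableAt ℝ (fderiv ℝ v) z := fun z hz =>
    ((hat z hz).fderiv_right (m := 1) (by norm_num)).differentiableAt (by simp)
  have hDc : ContinuousOn (fderiv ℝ v) s := fun z hz => (hD z hz).continuousAt.continuousWithinAt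
  have hDDc : ContinuousOn (fderiv ℝ (fderiv ℝ v)) s := fun z hz =>
    ((((hat z hz).fderiv_right (m := 1) (by norm_num)).fderiv_right
      (m := 0) (by norm_num)).continuousAt).continuousWithinAt
  set e : Fin n → (Fin n → ℝ) := fun i => Pi.single i 1 with he
  set f : Fin n → (Fin n → ℝ) → ℝ := fun i y => fderiv ℝ v (x + r • y) (e i) with hf
  have hmem : ∀ y ∈ closedBall (0 : Fin n → ℝ) 1, x + r • y ∈ s := fun y hy =>
    hsub (add_smul_mem_closedBall hr (by simpa using hy))
  have hfd : ∀ i, ∀ y ∈ closedBall (0 : Fin n → ℝ) 1,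
      HasFDerivAt (f i) (r • (fderiv ℝ (fderiv ℝ v) (x + r • y)).flip (e i)) y := by
    intro i y hy
    have h1 : HasFDerivAt (fun y : Fin n → ℝ => x + r • y)
        (r • ContinuousLinearMap.id ℝ (Fin n → ℝ)) y :=
      ((hasFDerivAt_id y).const_smul r).const_add x
    have h2 := (((hD _ (hmem y hy)).hasFDerivAt).comp y h1).clm_apply (hasFDerivAt_const (e i) y)
    refine h2.congr_fderiv ?_
    ext w
    simp
  have hfc : ∀ i, ContinuousOn (f i) (closedBall 0 1) := fun i y hy =>
    (hfd i y hy).continuousAt.continuousWithinAt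
  have hint1 : ∀ i, Integrable fun y => f i y * fderiv ℝ radialPotential y (e i) := by
    intro i
    simp only [he, fderiv_radialPotential_single]
    have hc : Continuous fun y : Fin n → ℝ => 2 * y i * radialBump y := by
      have := (contDiff_radialBump (n := n)).continuous
      fun_prop
    simpa only [smul_eq_mul, mul_comm] using
      integrable_smul_of_eq_zero (μ := volume) hc
        (fun y hy => by simp [radialBump_eq_zero y hy]) (hfc i)
  have hint2 : ∀ i, Integrable fun y =>
      r * iteratedFDeriv ℝ 2 v (x + r • y) (fun _ => e i) * radialPotential y := by
    intro i
    have hc : ContinuousOn (fun y => r * iteratedFDeriv ℝ 2 v (x + r • y) (fun _ => e i))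
        (closedBall 0 1) := by
      simp only [iteratedFDeriv_two_apply]
      have := continuousOn_comp_add_smul hDDc hr hsub
      exact continuousOn_const.mul ((this.clm_apply continuousOn_const).clm_apply
        continuousOn_const)
    simpa only [smul_eq_mul, mul_comm] using
      integrable_smul_of_eq_zero (μ := volume) continuous_radialPotential
        radialPotential_eq_zero hc
  have hibp : ∀ i, ∫ y, f i y * fderiv ℝ radialPotential y (e i) =
      - ∫ y, r * iteratedFDeriv ℝ 2 v (x + r • y) (fun _ => e i) * radialPotential y := by
    intro i
    have hts : tsupport (radialPotential (n := n)) ⊆ closedBall 0 1 :=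
      closure_minimal (fun y hy => by
        by_contra hy'
        exact hy (radialPotential_eq_zero y (by simpa using hy'))) isClosed_closedBall
    have hpart : ∀ y, fderiv ℝ (f i) y (e i) * radialPotential y =
        r * iteratedFDeriv ℝ 2 v (x + r • y) (fun _ => e i) * radialPotential y := by
      intro y
      by_cases hy : ‖y‖ ≤ 1
      · rw [(hfd i y (by simpa using hy)).fderiv, iteratedFDeriv_two_apply]
        simp
      · simp [radialPotential_eq_zero y (not_le.1 hy)]
    rw [integral_mul_fderiv_eq_neg_fderiv_mul_of_integrable]
    · simp only [hpart]
    · simp only [hpart]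
      exact hint2 i
    · exact hint1 i
    · simpa only [smul_eq_mul, mul_comm] using
        integrable_smul_of_eq_zero (μ := volume) continuous_radialPotential
          radialPotential_eq_zero (hfc i)
    · exact fun y hy => (hfd i y (hts hy)).differentiableAt
    · exact fun y _ => (hasFDerivAt_radialPotential y).differentiableAt
  have hexp : ∀ y, radialBump y * fderiv ℝ v (x + r • y) y =
      ∑ i, 2⁻¹ * (f i y * fderiv ℝ radialPotential y (e i)) := by
    intro y
    have h1 : fderiv ℝ v (x + r • y) y = ∑ i, y i * f i y := by
      have h2 : ∀ l : (Fin n → ℝ) →L[ℝ] ℝ, l y = ∑ i, y i * l (e i) := by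
        intro l
        conv_lhs => rw [pi_eq_sum_univ' y]
        simp only [map_sum, map_smul, smul_eq_mul, he]
      exact h2 _
    rw [h1, Finset.mul_sum]
    refine Finset.sum_congr rfl fun i _ => ?_
    rw [fderiv_radialPotential_single]
    ring
  simp only [hexp]
  rw [integral_finsetSum _ fun i _ => (hint1 i).const_mul _]
  simp only [integral_const_mul, hibp]
  rw [← Finset.mul_sum, Finset.sum_neg_distrib, ← integral_finsetSum _ fun i _ => hint2 i]
  have hzero : ∀ y, ∑ i, r * iteratedFDeriv ℝ 2 v (x + r • y) (fun _ => e i) *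
      radialPotential y = 0 := by
    intro y
    by_cases hy : ‖y‖ ≤ 1
    · rw [← Finset.sum_mul, ← Finset.mul_sum, hv.2 _ (hmem y (by simpa using hy))]
      simp
    · simp [radialPotential_eq_zero y (not_le.1 hy)]
  simp [hzero]

/-- Harmonic functions have the mean value property. -/
lemma IsHarmonicOn.hasMeanValue (hv : IsHarmonicOn v s) (hs : IsOpen s) :
    HasMeanValue volume (fun y => (∫ z : Fin n → ℝ, radialBump z)⁻¹ * radialBump y) v s := by
  refine ⟨hv.1.continuousOn, fun x r₀ hr₀ hsub => ?_⟩
  have hat : ∀ z ∈ s, ContDiffAt ℝ 2 v z := fun z hz => hv.1.contDiffAt (hs.mem_nhds hz)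
  have hDc : ContinuousOn (fderiv ℝ v) s := fun z hz =>
    (((hat z hz).fderiv_right (m := 0) (by norm_num)).continuousAt).continuousWithinAt
  obtain ⟨ε, hε, hεs⟩ := IsCompact.exists_closedBall_add_subset hr₀.le hs hsub
  obtain ⟨M, hM⟩ := (isCompact_closedBall x (ε + r₀)).exists_bound_of_continuousOn (hDc.mono hεs)
  have hbc := (contDiff_radialBump (n := n)).continuous
  have hmem : ∀ t : ℝ, |t| ≤ ε + r₀ → ∀ y : Fin n → ℝ, ‖y‖ ≤ 1 →
      x + t • y ∈ closedBall x (ε + r₀) := by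
    intro t ht y hy
    rw [mem_closedBall, dist_eq_norm, add_sub_cancel_left, norm_smul, Real.norm_eq_abs]
    nlinarith [abs_nonneg t]
  have hcomp : ∀ {G : Type} [TopologicalSpace G] {g : (Fin n → ℝ) → G}, ContinuousOn g s →
      ∀ t : ℝ, |t| ≤ ε + r₀ → ContinuousOn (fun y => g (x + t • y)) (closedBall 0 1) :=
    fun hg t ht => hg.comp (by fun_prop) fun y hy => hεs (hmem t ht y (by simpa using hy))
  set a : ℝ → ℝ := fun t => ∫ y, radialBump y * v (x + t • y) with ha
  have hnear : ∀ t ∈ Icc 0 r₀, ∀ t' ∈ ball t ε, |t'| ≤ ε + r₀ := by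
    intro t ht t' ht'
    have h1 : |t' - t| < ε := by simpa [Real.dist_eq] using ht'
    have h2 : |t'| ≤ |t' - t| + |t| := by simpa using abs_add_le (t' - t) t
    rw [abs_of_nonneg ht.1] at h2
    linarith [ht.2]
  have hder : ∀ t ∈ Icc 0 r₀, HasDerivAt a 0 t := by
    intro t ht
    have key := hasDerivAt_integral_of_dominated_loc_of_deriv_le (𝕜 := ℝ)
      (μ := (volume : Measure (Fin n → ℝ)))
      (F := fun t y => radialBump y * v (x + t • y))
      (F' := fun t y => radialBump y * fderiv ℝ v (x + t • y) y)
      (x₀ := t) (bound := fun y => |radialBump y| * M) (s := ball t ε) (ball_mem_nhds t hε)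
      ?_ ?_ ?_ ?_ ?_ ?_
    · have := key.2
      rwa [hv.integral_radialBump_mul_fderiv hs ht.1
        ((closedBall_subset_closedBall ht.2).trans hsub)] at this
    · filter_upwards [ball_mem_nhds t hε] with t' ht'
      exact (integrable_smul_of_eq_zero (μ := volume) hbc radialBump_eq_zero
        (hcomp hv.1.continuousOn t' (hnear t ht t' ht'))).1
    · exact integrable_smul_of_eq_zero (μ := volume) hbc radialBump_eq_zero
        (hcomp hv.1.continuousOn t (hnear t ht t (mem_ball_self hε)))
    · exact (integrable_smul_of_eq_zero (μ := volume) hbc radialBump_eq_zero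
        ((hcomp hDc t (hnear t ht t (mem_ball_self hε))).clm_apply continuousOn_id)).1
    · refine Eventually.of_forall fun y t' ht' => ?_
      rw [norm_mul, Real.norm_eq_abs]
      by_cases hy : ‖y‖ ≤ 1
      · gcongr
        have h1 := hM _ (hmem t' (hnear t ht t' ht') y hy)
        refine ((fderiv ℝ v (x + t' • y)).le_opNorm y).trans ?_
        nlinarith [norm_nonneg (fderiv ℝ v (x + t' • y))]
      · simp [radialBump_eq_zero y (not_le.1 hy)]
    · have hc : HasCompactSupport fun y : Fin n → ℝ => |radialBump y| :=
        HasCompactSupport.intro (isCompact_closedBall 0 1) fun y hy => by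
          simp [radialBump_eq_zero y (by simpa using hy)]
      exact (hbc.abs.integrable_of_hasCompactSupport hc).mul_const M
    · refine Eventually.of_forall fun y t' ht' => ?_
      by_cases hy : ‖y‖ ≤ 1
      · have h1 : DifferentiableAt ℝ v (x + t' • y) :=
          (hat _ (hεs (hmem t' (hnear t ht t' ht') y hy))).differentiableAt (by simp)
        have h2 : HasDerivAt (fun t : ℝ => x + t • y) y t' := by
          simpa using ((hasDerivAt_id t').smul_const y).const_add x
        exact (h1.hasFDerivAt.comp_hasDerivAt t' h2).const_mul _
      · simpa [radialBump_eq_zero y (not_le.1 hy)] using hasDerivAt_const t' (0 : ℝ)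
  have hconst := constant_of_has_deriv_right_zero
    (fun t ht => (hder t ht).continuousAt.continuousWithinAt)
    (fun t ht => (hder t (Ico_subset_Icc_self ht)).hasDerivWithinAt) r₀ ⟨hr₀.le, le_rfl⟩
  have h0 : a 0 = (∫ z : Fin n → ℝ, radialBump z) * v x := by
    simp [ha, integral_mul_const]
  simp only [smul_eq_mul, mul_assoc, integral_const_mul]
  change _ * a r₀ = _
  rw [hconst, h0, inv_mul_cancel_left₀ radialBump_integral_pos.ne']

end Harmonic

section GaussianFunctional

open MeasureTheory MvPolynomial

variable {n : ℕ}

lemma MvPolynomial.hasFDerivAt_eval (f : MvPolynomial (Fin n) ℝ) (x : Fin n → ℝ) :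
    HasFDerivAt (fun y => eval y f)
      (∑ i, eval x (pderiv i f) • ContinuousLinearMap.proj (R := ℝ) (φ := fun _ => ℝ) i) x := by
  induction f using MvPolynomial.induction_on with
  | C a => simpa using hasFDerivAt_const a x
  | add p q hp hq =>
    simp only [map_add, add_smul, Finset.sum_add_distrib]
    exact hp.add hq
  | mul_X p j hp =>
    have h := hp.mul (hasFDerivAt_apply (𝕜 := ℝ) j x)
    simp only [map_mul, eval_X]
    refine h.congr_fderiv ?_
    ext w
    have h1 : ∀ i, eval x (pderiv i (p * X j)) * w i =
        x j * (eval x (pderiv i p) * w i) + if j = i then eval x p * w i else 0 := fun i => by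
      rw [pderiv_mul, pderiv_X]
      by_cases hij : j = i
      · subst hij; simp; ring
      · simp [hij]; ring
    simp [-Derivation.leibniz, h1, Finset.sum_add_distrib, Finset.mul_sum, add_comm]

lemma MvPolynomial.fderiv_eval_single (f : MvPolynomial (Fin n) ℝ) (x : Fin n → ℝ) (i : Fin n) :
    fderiv ℝ (fun y => eval y f) x (Pi.single i 1) = eval x (pderiv i f) := by
  rw [(hasFDerivAt_eval f x).fderiv]
  simp [Pi.single_apply]

lemma MvPolynomial.contDiff_eval (f : MvPolynomial (Fin n) ℝ) {m : WithTop ℕ∞} :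
    ContDiff ℝ m fun y : Fin n → ℝ => eval y f := by
  induction f using MvPolynomial.induction_on with
  | C a => simpa using contDiff_const
  | add p q hp hq => simpa using hp.add hq
  | mul_X p j hp => simpa using hp.mul (contDiff_apply ℝ ℝ j)

lemma MvPolynomial.iteratedFDeriv_two_eval_single (f : MvPolynomial (Fin n) ℝ) (x : Fin n → ℝ)
    (i : Fin n) :
    iteratedFDeriv ℝ 2 (fun y => eval y f) x (fun _ => Pi.single i 1) =
      eval x (pderiv i (pderiv i f)) := by
  rw [iteratedFDeriv_two_apply, ← fderiv_eval_single]
  have h : ∀ y, eval y (pderiv i f) = fderiv ℝ (fun y => eval y f) y (Pi.single i 1) :=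
    fun y => (fderiv_eval_single f y i).symm
  have hd : DifferentiableAt ℝ (fderiv ℝ fun y : Fin n → ℝ => eval y f) x :=
    ((contDiff_eval f (m := 2)).fderiv_right (m := 1) (by norm_num)).differentiable (by simp) x
  simp only [h]
  rw [fderiv_clm_apply hd (differentiableAt_const _)]
  simp

lemma MvPolynomial.pderiv_comm (f : MvPolynomial (Fin n) ℝ) (i j : Fin n) :
    pderiv i (pderiv j f) = pderiv j (pderiv i f) := by
  ext m
  simp only [coeff_pderiv]
  rw [add_right_comm]
  by_cases h : i = j
  · subst h; ring
  · simp [h, Ne.symm h]; ring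

/-- The unnormalized standard Gaussian weight. -/
noncomputable def gaussianWeight (y : Fin n → ℝ) : ℝ := ∏ i, Real.exp (-(1 / 2) * y i ^ 2)

lemma gaussianWeight_pos (y : Fin n → ℝ) : 0 < gaussianWeight y :=
  Finset.prod_pos fun _ _ => Real.exp_pos _

lemma continuous_gaussianWeight : Continuous (gaussianWeight (n := n)) := by
  unfold gaussianWeight
  fun_prop

lemma hasFDerivAt_gaussianWeight (y : Fin n → ℝ) :
    HasFDerivAt gaussianWeight
      (-gaussianWeight y • ∑ i, y i • ContinuousLinearMap.proj (R := ℝ) (φ := fun _ => ℝ) i) y := by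
  have h0 : (gaussianWeight : (Fin n → ℝ) → ℝ) =
      fun y => Real.exp (∑ i, -(1 / 2) * y i ^ 2) := by
    ext y; simp only [gaussianWeight, Real.exp_sum]
  have h2 : HasFDerivAt (fun y : Fin n → ℝ => ∑ i, -(1 / 2) * y i ^ 2)
      (∑ i, (-(1 / 2) : ℝ) • (2 * y i) •
        ContinuousLinearMap.proj (R := ℝ) (φ := fun _ => ℝ) i) y := by
    refine HasFDerivAt.fun_sum fun i _ => ?_
    refine (((hasFDerivAt_apply (𝕜 := ℝ) i y).pow 2).const_mul (-(1 / 2) : ℝ)).congr_fderiv ?_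
    ext w
    simp
  rw [h0]
  refine h2.exp.congr_fderiv ?_
  ext w
  simp only [_root_.smul_apply, _root_.sum_apply,
    ContinuousLinearMap.proj_apply, smul_eq_mul, Finset.mul_sum]
  refine Finset.sum_congr rfl fun i _ => ?_
  ring

lemma fderiv_gaussianWeight_single (y : Fin n → ℝ) (i : Fin n) :
    fderiv ℝ gaussianWeight y (Pi.single i 1) = -(y i * gaussianWeight y) := by
  rw [(hasFDerivAt_gaussianWeight y).fderiv]
  simp [Pi.single_apply, mul_comm]

lemma integrable_eval_mul_gaussianWeight (f : MvPolynomial (Fin n) ℝ) :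
    Integrable fun y => eval y f * gaussianWeight y := by
  induction f using MvPolynomial.induction_on' with
  | monomial m a =>
    have h : ∀ k : ℕ, Integrable fun t : ℝ => t ^ k * Real.exp (-(1 / 2) * t ^ 2) := fun k => by
      simpa using integrable_rpow_mul_exp_neg_mul_sq (b := 1 / 2) (by norm_num)
        (s := k) (by linarith [k.cast_nonneg (α := ℝ)])
    have h1 := (Integrable.fintype_prod (μ := fun _ : Fin n => (volume : Measure ℝ))
      (f := fun i t => t ^ (m i) * Real.exp (-(1 / 2) * t ^ 2)) fun i => h (m i)).const_mul a
    refine h1.congr (Filter.Eventually.of_forall fun y => ?_)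
    simp [eval_monomial, Finsupp.prod_fintype, gaussianWeight, Finset.prod_mul_distrib, mul_assoc]
  | add p q hp hq =>
    simp only [map_add, add_mul]
    exact hp.add hq

/-- Integration of a polynomial against the Gaussian weight. -/
noncomputable def gaussianIntegral (f : MvPolynomial (Fin n) ℝ) : ℝ :=
  ∫ y, eval y f * gaussianWeight y

lemma gaussianIntegral_add (f g : MvPolynomial (Fin n) ℝ) :
    gaussianIntegral (f + g) = gaussianIntegral f + gaussianIntegral g := by
  unfold gaussianIntegral
  simp only [map_add, add_mul]
  exact integral_add (integrable_eval_mul_gaussianWeight f) (integrable_eval_mul_gaussianWeight g)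

lemma gaussianIntegral_zero : gaussianIntegral (0 : MvPolynomial (Fin n) ℝ) = 0 := by
  simp [gaussianIntegral]

lemma gaussianIntegral_nsmul (k : ℕ) (f : MvPolynomial (Fin n) ℝ) :
    gaussianIntegral (k • f) = k * gaussianIntegral f := by
  simp [gaussianIntegral, mul_assoc, integral_const_mul]

lemma gaussianIntegral_sum {ι : Type*} (s : Finset ι) (f : ι → MvPolynomial (Fin n) ℝ) :
    gaussianIntegral (∑ i ∈ s, f i) = ∑ i ∈ s, gaussianIntegral (f i) := by
  classical
  induction s using Finset.induction_on with
  | empty => simp [gaussianIntegral_zero]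
  | insert a s ha ih => rw [Finset.sum_insert ha, Finset.sum_insert ha, gaussianIntegral_add, ih]

/-- Gaussian integration by parts. -/
lemma gaussianIntegral_X_mul (f : MvPolynomial (Fin n) ℝ) (i : Fin n) :
    gaussianIntegral (X i * f) = gaussianIntegral (pderiv i f) := by
  have h1 : ∀ y : Fin n → ℝ, eval y f * fderiv ℝ gaussianWeight y (Pi.single i 1) =
      -(eval y (X i * f) * gaussianWeight y) := fun y => by
    rw [fderiv_gaussianWeight_single]
    simp only [map_mul, eval_X]
    ring
  have h := integral_mul_fderiv_eq_neg_fderiv_mul_of_integrable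
    (μ := (volume : Measure (Fin n → ℝ))) (f := fun y => eval y f) (g := gaussianWeight)
    (v := Pi.single i 1) ?_ ?_ (integrable_eval_mul_gaussianWeight f)
    (fun y _ => (hasFDerivAt_eval f y).differentiableAt)
    (fun y _ => (hasFDerivAt_gaussianWeight y).differentiableAt)
  · simp only [h1, fderiv_eval_single, integral_neg, neg_inj] at h
    exact h
  · simp only [fderiv_eval_single]
    exact integrable_eval_mul_gaussianWeight _
  · simp only [h1]
    exact (integrable_eval_mul_gaussianWeight _).neg

/-- Homogeneous harmonic polynomials are orthogonal to all polynomials of lower degree. -/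
lemma gaussianIntegral_mul_eq_zero {k : ℕ} {p r : MvPolynomial (Fin n) ℝ}
    (hp : p.IsHomogeneous k) (hharm : ∑ i, pderiv i (pderiv i p) = 0)
    (hr : ∀ m, coeff m r ≠ 0 → m.degree < k) : gaussianIntegral (p * r) = 0 := by
  induction k generalizing p r with
  | zero =>
    have : r = 0 := by
      ext m
      by_contra h
      exact absurd (hr m h) (by simp)
    simp [this, gaussianIntegral_zero]
  | succ k ih =>
    have hterm : ∀ i, gaussianIntegral (pderiv i p * pderiv i r) = 0 := by
      intro i
      refine ih (by simpa using hp.pderiv (i := i)) ?_ fun m hm => ?_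
      · simp only [fun j => pderiv_comm p j i, fun j => pderiv_comm (pderiv j p) j i]
        rw [← map_sum, hharm, map_zero]
      · rw [coeff_pderiv] at hm
        have := hr _ (left_ne_zero_of_mul hm)
        simpa using this
    have hE := hp.sum_X_mul_pderiv
    have h1 : ((k + 1 : ℕ) : ℝ) * gaussianIntegral (p * r) = 0 := by
      rw [← gaussianIntegral_nsmul, ← smul_mul_assoc, ← hE, Finset.sum_mul, gaussianIntegral_sum]
      have h2 : ∀ i, gaussianIntegral (X i * pderiv i p * r) =
          gaussianIntegral (pderiv i (pderiv i p) * r) := by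
        intro i
        rw [mul_assoc, gaussianIntegral_X_mul, pderiv_mul, gaussianIntegral_add, hterm, add_zero]
      simp only [h2]
      rw [← gaussianIntegral_sum, ← Finset.sum_mul, hharm, zero_mul, gaussianIntegral_zero]
    have hk : ((k + 1 : ℕ) : ℝ) ≠ 0 := by positivity
    exact (mul_eq_zero.1 h1).resolve_left hk

/-- A nonnegative factor of a nonzero homogeneous harmonic polynomial is constant. -/
lemma totalDegree_eq_zero_of_nonneg {k : ℕ} {h g : MvPolynomial (Fin n) ℝ}
    (hp : (h * g).IsHomogeneous k) (hharm : ∑ i, pderiv i (pderiv i (h * g)) = 0)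
    (hne : h * g ≠ 0) (hpos : ∀ x, 0 ≤ eval x h) : h.totalDegree = 0 := by
  by_contra hdeg
  have hh : h ≠ 0 := left_ne_zero_of_mul hne
  have hg : g ≠ 0 := right_ne_zero_of_mul hne
  have hk : h.totalDegree + g.totalDegree = k := by
    rw [← totalDegree_mul_of_isDomain hh hg, hp.totalDegree hne]
  have hz : gaussianIntegral (h * g * g) = 0 :=
    gaussianIntegral_mul_eq_zero hp hharm fun m hm => by
      have : m.degree ≤ g.totalDegree := by
        rw [Finsupp.degree_apply]
        exact le_totalDegree (mem_support_iff.2 hm)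
      omega
  have hnn : ∀ y, 0 ≤ eval y (h * g * g) * gaussianWeight y := fun y => by
    have := hpos y
    have := gaussianWeight_pos y
    rw [map_mul, map_mul, mul_assoc (eval y h)]
    have := mul_self_nonneg (eval y g)
    positivity
  have hc : Continuous fun y : Fin n → ℝ => eval y (h * g * g) * gaussianWeight y :=
    (contDiff_eval _ (m := 0)).continuous.mul continuous_gaussianWeight
  have hae := (integral_eq_zero_iff_of_nonneg hnn (integrable_eval_mul_gaussianWeight _)).1 hz
  have hfun := (hc.ae_eq_iff_eq (μ := volume) continuous_zero).1 hae
  have : h * g * g = 0 := MvPolynomial.funext fun y => by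
    have := congrFun hfun y
    simpa [(gaussianWeight_pos y).ne'] using this
  exact mul_ne_zero hne hg this

/-- A nonpositive factor of a nonzero homogeneous harmonic polynomial is constant. -/
lemma totalDegree_eq_zero_of_nonpos {k : ℕ} {h g : MvPolynomial (Fin n) ℝ}
    (hp : (h * g).IsHomogeneous k) (hharm : ∑ i, pderiv i (pderiv i (h * g)) = 0)
    (hne : h * g ≠ 0) (hneg : ∀ x, eval x h ≤ 0) : h.totalDegree = 0 := by
  rw [← totalDegree_neg]
  rw [← neg_mul_neg] at hp hharm hne
  exact totalDegree_eq_zero_of_nonneg hp hharm hne fun x => by simpa using hneg x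

end GaussianFunctional

section SignChange

open Filter Topology

namespace Polynomial

variable {R : Type*} [CommRing R] [IsDomain R] [UniqueFactorizationMonoid R]

/-- Relatively prime polynomials over a unique factorization domain generate an ideal which
contains a nonzero constant. -/
lemma exists_mul_add_mul_eq_C {A B : R[X]} (hAB : IsRelPrime A B) (hA : A ≠ 0) :
    ∃ a b : R[X], ∃ c : R, c ≠ 0 ∧ a * A + b * B = C c := by
  classical
  let _ : StrongNormalizationMonoid R := UniqueFactorizationMonoid.strongNormalizationMonoid
  let _ : NormalizedGCDMonoid R := UniqueFactorizationMonoid.toNormalizedGCDMonoid R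
  let K := FractionRing R
  have hinj : Function.Injective (algebraMap R K) := IsFractionRing.injective R K
  have hrel : IsRelPrime (A.map (algebraMap R K)) (B.map (algebraMap R K)) := by
    intro d hdA hdB
    have hd0 : d ≠ 0 := by
      rintro rfl
      exact hA ((Polynomial.map_eq_zero_iff hinj).1 (zero_dvd_iff.1 hdA))
    obtain ⟨b, hb, hbd⟩ := IsLocalization.integerNormalization_spec (nonZeroDivisors R) d
    have hbu : IsUnit (C (algebraMap R K b)) := by
      refine isUnit_C.2 (IsUnit.mk0 _ ?_)
      simpa using hinj.ne (nonZeroDivisors.ne_zero hb)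
    have hsm : b • d = C (algebraMap R K b) * d := by
      rw [← smul_eq_C_mul, algebraMap_smul]
    set D := IsLocalization.integerNormalization (nonZeroDivisors R) d with hD
    have hdvd : ∀ P : R[X], d ∣ P.map (algebraMap R K) → D.primPart ∣ P := by
      intro P hP
      refine D.isPrimitive_primPart.dvd_of_fraction_map_dvd_fraction_map (K := K) ?_
      have h1 : D.primPart.map (algebraMap R K) ∣ D.map (algebraMap R K) :=
        (Polynomial.mapRingHom (algebraMap R K)).map_dvd D.primPart_dvd
      refine h1.trans ?_
      rw [hbd, hsm]
      exact (hbu.mul_left_dvd).2 hP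
    exact isUnit_or_eq_zero_of_isUnit_integerNormalization_primPart hd0
      (hAB (hdvd A hdA) (hdvd B hdB))
  obtain ⟨a, b, hab⟩ := hrel.isCoprime
  obtain ⟨s, hs, hsa⟩ := IsLocalization.integerNormalization_spec (nonZeroDivisors R) a
  obtain ⟨t, ht, htb⟩ := IsLocalization.integerNormalization_spec (nonZeroDivisors R) b
  refine ⟨C t * IsLocalization.integerNormalization (nonZeroDivisors R) a,
    C s * IsLocalization.integerNormalization (nonZeroDivisors R) b, t * s,
    mul_ne_zero (nonZeroDivisors.ne_zero ht) (nonZeroDivisors.ne_zero hs), ?_⟩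
  apply Polynomial.map_injective _ hinj
  have hsm : ∀ (s : R) (d : K[X]), s • d = C (algebraMap R K s) * d := fun s d => by
    rw [← smul_eq_C_mul, algebraMap_smul]
  simp only [Polynomial.map_add, Polynomial.map_mul, map_C, hsa, htb, hsm, map_mul]
  linear_combination (C (algebraMap R K t) * C (algebraMap R K s)) * hab

/-- A real polynomial positive at `0` and negative at `1` changes sign somewhere. -/
lemma exists_frequently_pos_frequently_neg {P : Polynomial ℝ} (h0 : 0 < P.eval 0)
    (h1 : P.eval 1 < 0) :
    ∃ T, (∃ᶠ t in 𝓝 T, 0 < P.eval t) ∧ ∃ᶠ t in 𝓝 T, P.eval t < 0 := by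
  have hP : P ≠ 0 := by rintro rfl; simp at h0
  set S : Set ℝ := {t | t ≤ 1 ∧ 0 < P.eval t} with hS
  have hne : S.Nonempty := ⟨0, zero_le_one, h0⟩
  have hbdd : BddAbove S := ⟨1, fun t ht => ht.1⟩
  have hpos : ∃ᶠ t in 𝓝 (sSup S), 0 < P.eval t :=
    (mem_closure_iff_frequently.1 (csSup_mem_closure hne hbdd)).mono fun t ht => ht.2
  have hT1 : sSup S < 1 := by
    refine lt_of_le_of_ne (csSup_le hne fun t ht => ht.1) fun h => ?_
    rw [h] at hpos
    exact hpos ((P.continuous.continuousAt.eventually_lt continuousAt_const h1).mono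
      fun t ht => not_lt.2 ht.le)
  refine ⟨sSup S, hpos, ?_⟩
  have hfin : (P.rootSet ℝ).Finite := P.rootSet_finite ℝ
  have hev : ∀ᶠ t in 𝓝[>] (sSup S), P.eval t < 0 := by
    have e1 : ∀ᶠ t in 𝓝[>] (sSup S), t < 1 :=
      nhdsWithin_le_nhds (eventually_lt_nhds hT1)
    have e2 : ∀ᶠ t in 𝓝[>] (sSup S), t ∉ P.rootSet ℝ := by
      have : (P.rootSet ℝ \ {sSup S})ᶜ ∈ 𝓝 (sSup S) :=
        (hfin.subset Set.sdiff_subset).isClosed.isOpen_compl.mem_nhds (by simp)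
      filter_upwards [nhdsWithin_le_nhds this, self_mem_nhdsWithin] with t ht ht'
      exact fun hr => ht ⟨hr, ht'.ne'⟩
    filter_upwards [e1, e2, self_mem_nhdsWithin] with t ht1 ht2 ht3
    refine lt_of_le_of_ne (not_lt.1 fun hpos => ?_) fun h => ht2 ?_
    · exact absurd (le_csSup hbdd ⟨ht1.le, hpos⟩) (not_le.2 ht3)
    · rw [mem_rootSet]
      exact ⟨hP, by simpa using h⟩
  exact hev.frequently.filter_mono nhdsWithin_le_nhds

end Polynomial

namespace MvPolynomial

variable {n : ℕ}

/-- Restriction of a polynomial to the lines of direction `d`, with generic base point. -/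
noncomputable def lineRestrict (d : Fin n → ℝ) :
    MvPolynomial (Fin n) ℝ →+* Polynomial (MvPolynomial (Fin n) ℝ) :=
  eval₂Hom (Polynomial.C.comp C) fun i => Polynomial.C (X i) + Polynomial.C (C (d i)) * Polynomial.X

/-- Shearing along the direction `d`. -/
noncomputable def shear (d : Fin n → ℝ) :
    Polynomial (MvPolynomial (Fin n) ℝ) →+* Polynomial (MvPolynomial (Fin n) ℝ) :=
  Polynomial.eval₂RingHom (lineRestrict d) Polynomial.X

lemma shear_neg_shear (d : Fin n → ℝ) (P : Polynomial (MvPolynomial (Fin n) ℝ)) :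
    shear (-d) (shear d P) = P := by
  have h : (shear (-d)).comp (shear d) = RingHom.id _ := by
    refine Polynomial.ringHom_ext (fun f => ?_) (by simp [shear])
    have h2 : ((shear (-d)).comp (lineRestrict d)) = Polynomial.C := by
      refine MvPolynomial.ringHom_ext (fun r => ?_) fun i => ?_
      · simp [shear, lineRestrict]
      · simp [shear, lineRestrict]
        ring
    simpa [shear] using congrArg (fun g => g f) h2
  exact congrArg (fun g => g P) h

lemma isRelPrime_lineRestrict {h Q : MvPolynomial (Fin n) ℝ} (hh : h ≠ 0) (hQ : IsRelPrime h Q)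
    (d : Fin n → ℝ) : IsRelPrime (lineRestrict d h) (lineRestrict d Q) := by
  intro D hDh hDQ
  have hC : ∀ f, shear (-d) (lineRestrict d f) = Polynomial.C f := fun f => by
    have := shear_neg_shear d (Polynomial.C f)
    simpa [shear] using this
  have h1 := map_dvd (shear (-d)) hDh
  have h2 := map_dvd (shear (-d)) hDQ
  rw [hC] at h1 h2
  have hdeg : (shear (-d) D).natDegree = 0 := by
    have := Polynomial.natDegree_le_of_dvd h1 (Polynomial.C_ne_zero.2 hh)
    simpa using this
  obtain ⟨e, he⟩ := Polynomial.natDegree_eq_zero.1 hdeg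
  rw [← he, Polynomial.C_dvd_iff_dvd_coeff] at h1 h2
  have hu : IsUnit e := hQ (by simpa using h1 0) (by simpa using h2 0)
  have hu' : IsUnit (shear (-d) D) := he ▸ hu.map Polynomial.C
  have h3 := hu'.map (shear d)
  have h4 := shear_neg_shear (-d) D
  rw [neg_neg] at h4
  rwa [h4] at h3

lemma eval_map_lineRestrict (d x : Fin n → ℝ) (t : ℝ) (f : MvPolynomial (Fin n) ℝ) :
    ((lineRestrict d f).map (eval x)).eval t = eval (x + t • d) f := by
  have h : ((Polynomial.evalRingHom t).comp (Polynomial.mapRingHom (eval x))).comp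
      (lineRestrict d) = eval (x + t • d) := by
    refine MvPolynomial.ringHom_ext (fun r => ?_) fun i => ?_
    · simp [lineRestrict]
    · simp [lineRestrict]
      ring
  exact congrArg (fun g => g f) h

lemma continuous_eval_real (f : MvPolynomial (Fin n) ℝ) :
    Continuous fun x : Fin n → ℝ => eval x f := 
  (contDiff_eval f (m := 0)).continuous

lemma exists_eval_ne_zero_of_isOpen {c : MvPolynomial (Fin n) ℝ} (hc : c ≠ 0)
    {U : Set (Fin n → ℝ)} (hU : IsOpen U) {a : Fin n → ℝ} (ha : a ∈ U) :
    ∃ x ∈ U, eval x c ≠ 0 := by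
  by_contra! h
  obtain ⟨ε, hε, hεU⟩ := Metric.isOpen_iff.1 hU a ha
  refine hc (funext_set (fun i => Metric.ball (a i) ε) (fun i => ?_) fun x hx => ?_)
  · rw [Real.ball_eq_Ioo]
    exact Set.Ioo_infinite (by linarith)
  · rw [map_zero]
    exact h x (hεU (by rwa [ball_pi a hε]))

/-- If `h` takes both signs and is relatively prime to `Q`, then `h` changes sign at some point
where `Q` does not vanish. -/
lemma exists_signChange_eval_ne_zero {h Q : MvPolynomial (Fin n) ℝ} (hQ : IsRelPrime h Q)
    {a b : Fin n → ℝ} (ha : 0 < eval a h) (hb : eval b h < 0) :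
    ∃ z, eval z Q ≠ 0 ∧ (∃ᶠ y in 𝓝 z, 0 < eval y h) ∧ ∃ᶠ y in 𝓝 z, eval y h < 0 := by
  have hh : h ≠ 0 := by rintro rfl; simp at ha
  set d := b - a with hd
  have hcont := continuous_eval_real h
  have hinj : lineRestrict d h ≠ 0 := by
    intro h0
    have := eval_map_lineRestrict d a 0 h
    simp [h0] at this
    exact ha.ne this
  obtain ⟨A, B, c, hc, hABc⟩ :=
    Polynomial.exists_mul_add_mul_eq_C (isRelPrime_lineRestrict hh hQ d) hinj
  obtain ⟨x, ⟨hx0, hx1⟩, hxc⟩ := exists_eval_ne_zero_of_isOpen hc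
    (U := {x | 0 < eval x h ∧ eval (x + d) h < 0})
    ((isOpen_lt continuous_const hcont).inter
      (isOpen_lt (hcont.comp (continuous_id.add continuous_const)) continuous_const))
    (a := a) ⟨ha, by simpa [hd] using hb⟩
  obtain ⟨T, hT1, hT2⟩ := Polynomial.exists_frequently_pos_frequently_neg
    (P := (lineRestrict d h).map (eval x)) (by rw [eval_map_lineRestrict]; simpa using hx0)
    (by rw [eval_map_lineRestrict]; simpa using hx1)
  simp only [eval_map_lineRestrict] at hT1 hT2
  have htend : Tendsto (fun t : ℝ => x + t • d) (𝓝 T) (𝓝 (x + T • d)) :=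
    (by fun_prop : Continuous fun t : ℝ => x + t • d).tendsto T
  have hp := htend.frequently (p := fun y => 0 < eval y h) hT1
  have hn := htend.frequently (p := fun y => eval y h < 0) hT2
  refine ⟨x + T • d, fun hz => hxc ?_, hp, hn⟩
  have hz' : eval (x + T • d) h = 0 := by
    rcases lt_trichotomy (eval (x + T • d) h) 0 with hlt | heq | hgt
    · exact absurd ((hcont.continuousAt.eventually_lt continuousAt_const hlt).mono
        fun y hy => not_lt.2 hy.le) hp
    · exact heq
    · exact absurd ((continuousAt_const.eventually_lt hcont.continuousAt hgt).mono
        fun y hy => not_lt.2 hy.le) hn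
  have := congrArg (fun P => (P.map (eval x)).eval T) hABc
  simpa [eval_map_lineRestrict, hz, hz'] using this.symm

lemma isUnit_of_totalDegree_eq_zero {f : MvPolynomial (Fin n) ℝ} (hf : f ≠ 0)
    (h : f.totalDegree = 0) : IsUnit f := by
  rw [totalDegree_eq_zero_iff_eq_C] at h
  rw [h] at hf ⊢
  refine IsUnit.map C (IsUnit.mk0 _ fun h0 => hf ?_)
  rw [h0, C_0]

/-- A polynomial vanishing wherever a nonzero homogeneous harmonic polynomial changes sign is
divisible by it. -/
lemma dvd_of_eval_eq_zero_of_signChange {k : ℕ} {p q : MvPolynomial (Fin n) ℝ}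
    (hp : p.IsHomogeneous k) (hharm : ∑ i, pderiv i (pderiv i p) = 0) (hp0 : p ≠ 0)
    (hq : ∀ z, (∃ᶠ y in 𝓝 z, 0 < eval y p) → (∃ᶠ y in 𝓝 z, eval y p < 0) → eval z q = 0) :
    p ∣ q := by
  obtain ⟨h, s, g, hhs, rfl, rfl⟩ := UniqueFactorizationMonoid.exists_reduced_factors p hp0 q
  have hg0 : g ≠ 0 := left_ne_zero_of_mul hp0
  have hh0 : h ≠ 0 := right_ne_zero_of_mul hp0
  have hunit : IsUnit h → g * h ∣ g * s := fun hu => mul_dvd_mul_left g hu.dvd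
  have hhg : IsRelPrime h g := by
    rintro d ⟨e, rfl⟩ ⟨f, rfl⟩
    have hd0 : d ≠ 0 := left_ne_zero_of_mul hh0
    have heq : d * f * (d * e) = d * d * (f * e) := by ring
    rw [heq] at hp hharm hp0
    have h0 := totalDegree_eq_zero_of_nonneg hp hharm hp0 fun x => by
      rw [map_mul]; exact mul_self_nonneg _
    rw [totalDegree_mul_of_isDomain hd0 hd0] at h0
    exact isUnit_of_totalDegree_eq_zero hd0 (by omega)
  by_cases hpos : ∃ a, 0 < eval a h
  · by_cases hneg : ∃ b, eval b h < 0
    · obtain ⟨a, ha⟩ := hpos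
      obtain ⟨b, hb⟩ := hneg
      obtain ⟨z, hz, hz1, hz2⟩ := exists_signChange_eval_ne_zero (hhg.mul_right hhs) ha hb
      refine absurd (hq z ?_ ?_) hz
      all_goals
        have hgz : eval z g ≠ 0 := fun h0 => hz (by simp [h0])
        have hcg := (continuous_eval_real g).continuousAt (x := z)
        simp only [map_mul]
        rcases lt_or_gt_of_ne hgz with hlt | hgt
      · exact (hz2.and_eventually (hcg.eventually_lt continuousAt_const hlt)).mono
          fun y hy => mul_pos_of_neg_of_neg hy.2 hy.1
      · exact (hz1.and_eventually (continuousAt_const.eventually_lt hcg hgt)).mono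
          fun y hy => mul_pos hy.2 hy.1
      · exact (hz1.and_eventually (hcg.eventually_lt continuousAt_const hlt)).mono
          fun y hy => mul_neg_of_neg_of_pos hy.2 hy.1
      · exact (hz2.and_eventually (continuousAt_const.eventually_lt hcg hgt)).mono
          fun y hy => mul_neg_of_pos_of_neg hy.2 hy.1
    · push Not at hneg
      rw [mul_comm g h] at hp hharm hp0
      exact hunit (isUnit_of_totalDegree_eq_zero hh0
        (totalDegree_eq_zero_of_nonneg hp hharm hp0 hneg))
  · push Not at hpos
    rw [mul_comm g h] at hp hharm hp0
    exact hunit (isUnit_of_totalDegree_eq_zero hh0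
      (totalDegree_eq_zero_of_nonpos hp hharm hp0 hpos))

end MvPolynomial

end SignChange

section WeightedNorm

open MvPolynomial

variable {n : ℕ}

/-- The `ℓ¹` norm of the coefficients of a polynomial, with monomial weights `ρ ^ m`. -/
noncomputable def weightedNorm (ρ : Fin n → ℝ) (p : MvPolynomial (Fin n) ℝ) : ℝ :=
  ∑ m ∈ p.support, |coeff m p| * ∏ i, ρ i ^ m i

variable {ρ : Fin n → ℝ}

lemma weightedNorm_eq_sum {p : MvPolynomial (Fin n) ℝ} {s : Finset (Fin n →₀ ℕ)}
    (hs : p.support ⊆ s) : weightedNorm ρ p = ∑ m ∈ s, |coeff m p| * ∏ i, ρ i ^ m i :=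
  Finset.sum_subset hs fun m _ hm => by simp [notMem_support_iff.1 hm]

lemma weightedNorm_nonneg (hρ : ∀ i, 0 ≤ ρ i) (p : MvPolynomial (Fin n) ℝ) :
    0 ≤ weightedNorm ρ p :=
  Finset.sum_nonneg fun _ _ =>
    mul_nonneg (abs_nonneg _) (Finset.prod_nonneg fun i _ => pow_nonneg (hρ i) _)

lemma weightedNorm_zero : weightedNorm ρ (0 : MvPolynomial (Fin n) ℝ) = 0 := by
  simp [weightedNorm]

lemma weightedNorm_neg (p : MvPolynomial (Fin n) ℝ) :
    weightedNorm ρ (-p) = weightedNorm ρ p := by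
  simp [weightedNorm, support_neg]

lemma weightedNorm_add_le (hρ : ∀ i, 0 ≤ ρ i) (p q : MvPolynomial (Fin n) ℝ) :
    weightedNorm ρ (p + q) ≤ weightedNorm ρ p + weightedNorm ρ q := by
  classical
  rw [weightedNorm_eq_sum (p := p + q) (support_add (p := p) (q := q)),
    weightedNorm_eq_sum (p := p) (Finset.subset_union_left (s₂ := q.support)),
    weightedNorm_eq_sum (p := q) (Finset.subset_union_right (s₁ := p.support)),
    ← Finset.sum_add_distrib]
  refine Finset.sum_le_sum fun m _ => ?_
  rw [← add_mul, coeff_add]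
  exact mul_le_mul_of_nonneg_right (abs_add_le _ _)
    (Finset.prod_nonneg fun i _ => pow_nonneg (hρ i) _)

lemma weightedNorm_sub_le (hρ : ∀ i, 0 ≤ ρ i) (p q : MvPolynomial (Fin n) ℝ) :
    weightedNorm ρ (p - q) ≤ weightedNorm ρ p + weightedNorm ρ q := by
  rw [sub_eq_add_neg, ← weightedNorm_neg q]
  exact weightedNorm_add_le hρ p (-q)

lemma weightedNorm_sum_le (hρ : ∀ i, 0 ≤ ρ i) {ι : Type*} (s : Finset ι)
    (f : ι → MvPolynomial (Fin n) ℝ) :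
    weightedNorm ρ (∑ i ∈ s, f i) ≤ ∑ i ∈ s, weightedNorm ρ (f i) := by
  classical
  induction s using Finset.induction_on with
  | empty => simp [weightedNorm_zero]
  | insert a s ha ih =>
    rw [Finset.sum_insert ha, Finset.sum_insert ha]
    exact (weightedNorm_add_le hρ _ _).trans (by gcongr)

lemma weightedNorm_monomial_mul (m : Fin n →₀ ℕ) (c : ℝ) (q : MvPolynomial (Fin n) ℝ) :
    weightedNorm ρ (monomial m c * q) = |c| * (∏ i, ρ i ^ m i) * weightedNorm ρ q := by
  have hs : (monomial m c * q).support ⊆ q.support.map (addLeftEmbedding m) := by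
    intro k hk
    rw [mem_support_iff, coeff_monomial_mul'] at hk
    simp only [ne_eq, ite_eq_right_iff, Classical.not_imp] at hk
    rw [Finset.mem_map]
    exact ⟨k - m, mem_support_iff.2 (right_ne_zero_of_mul hk.2),
      add_tsub_cancel_of_le hk.1⟩
  rw [weightedNorm_eq_sum hs, Finset.sum_map, weightedNorm, Finset.mul_sum]
  refine Finset.sum_congr rfl fun k _ => ?_
  simp only [addLeftEmbedding_apply, Finsupp.add_apply, pow_add, Finset.prod_mul_distrib]
  rw [add_comm m k, add_comm k m, coeff_monomial_mul, abs_mul]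
  ring

lemma weightedNorm_mul_le (hρ : ∀ i, 0 ≤ ρ i) (p q : MvPolynomial (Fin n) ℝ) :
    weightedNorm ρ (p * q) ≤ weightedNorm ρ p * weightedNorm ρ q := by
  conv_lhs => rw [p.as_sum, Finset.sum_mul]
  refine (weightedNorm_sum_le hρ _ _).trans (le_of_eq ?_)
  simp only [weightedNorm_monomial_mul]
  rw [← Finset.sum_mul]
  rfl

lemma weightedNorm_mono {σ : Fin n → ℝ} (hρ : ∀ i, 0 ≤ ρ i) (h : ∀ i, ρ i ≤ σ i)
    (p : MvPolynomial (Fin n) ℝ) : weightedNorm ρ p ≤ weightedNorm σ p := by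
  unfold weightedNorm
  gcongr with m _ i _
  · exact fun i _ => pow_nonneg (hρ i) _
  · exact hρ i
  · exact h i

lemma weightedNorm_const_of_isHomogeneous {p : MvPolynomial (Fin n) ℝ} {d : ℕ}
    (hp : p.IsHomogeneous d) (M : ℝ) :
    weightedNorm (fun _ => M) p = M ^ d * weightedNorm 1 p := by
  unfold weightedNorm
  rw [Finset.mul_sum]
  refine Finset.sum_congr rfl fun m hm => ?_
  have hd : ∑ i, m i = d := by
    rw [hp.degree_eq_sum_deg_support hm, ← Finsupp.degree_apply, Finsupp.degree_eq_sum]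
  rw [Finset.prod_pow_eq_pow_sum, hd]
  simp [mul_comm]

lemma abs_eval_le_weightedNorm {y : Fin n → ℝ} (hy : ∀ i, |y i| ≤ ρ i)
    (p : MvPolynomial (Fin n) ℝ) : |eval y p| ≤ weightedNorm ρ p := by
  rw [eval_eq']
  refine (Finset.abs_sum_le_sum_abs _ _).trans (Finset.sum_le_sum fun m _ => ?_)
  rw [abs_mul, Finset.abs_prod]
  gcongr with i _
  rw [abs_pow]
  gcongr
  exact hy i

lemma abs_eval_le_of_isHomogeneous {p : MvPolynomial (Fin n) ℝ} {d : ℕ}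
    (hp : p.IsHomogeneous d) (y : Fin n → ℝ) :
    |eval y p| ≤ weightedNorm 1 p * ‖y‖ ^ d := by
  rw [mul_comm, ← weightedNorm_const_of_isHomogeneous hp]
  exact abs_eval_le_weightedNorm (fun i => norm_le_pi_norm y i) p

/-- For a suitable choice of weights, multiplication by a fixed nonzero polynomial is bounded
below. -/
lemma exists_weightedNorm_le_mul {p : MvPolynomial (Fin n) ℝ} (hp : p ≠ 0) :
    ∃ ρ : Fin n → ℝ, (∀ i, 0 < ρ i) ∧ ∃ K : ℝ, 0 ≤ K ∧
      ∀ g, weightedNorm ρ g ≤ K * weightedNorm ρ (p * g) := by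
  obtain ⟨a, ha, hmax⟩ := p.support.exists_max_image (fun m => ∑ i, m i ^ 2)
    (support_nonempty.2 hp)
  have hlt : ∀ b ∈ p.support, b ≠ a → ∑ i, a i * b i + 1 ≤ ∑ i, a i * a i := by
    intro b hb hba
    have h1 := hmax b hb
    have h2 : 0 < ∑ i, ((a i : ℤ) - b i) ^ 2 := by
      obtain ⟨i, hi⟩ := Finsupp.ne_iff.1 hba
      refine Finset.sum_pos' (fun i _ => sq_nonneg _) ⟨i, Finset.mem_univ i, ?_⟩
      have : ((a i : ℤ) - b i) ≠ 0 := by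
        intro h0
        exact hi (by omega)
      positivity
    have h3 : ∑ i, ((a i : ℤ) - b i) ^ 2 =
        ∑ i, (a i : ℤ) ^ 2 + ∑ i, (b i : ℤ) ^ 2 - 2 * ∑ i, (a i : ℤ) * b i := by
      rw [Finset.mul_sum, ← Finset.sum_add_distrib, ← Finset.sum_sub_distrib]
      exact Finset.sum_congr rfl fun i _ => by ring
    zify at h1 ⊢
    simp only [← sq]
    linarith
  have hc : 0 < |coeff a p| := abs_pos.2 (mem_support_iff.1 ha)
  set S : ℝ := ∑ m ∈ p.support, |coeff m p| with hS
  set T : ℝ := 1 + 2 * S / |coeff a p| with hT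
  have hS0 : 0 ≤ S := Finset.sum_nonneg fun _ _ => abs_nonneg _
  have hT1 : 1 ≤ T := by rw [hT]; linarith [div_nonneg (mul_nonneg zero_le_two hS0) hc.le]
  have hT0 : 0 < T := one_pos.trans_le hT1
  set ρ : Fin n → ℝ := fun i => T ^ a i with hρ
  have hρ0 : ∀ i, 0 < ρ i := fun i => pow_pos hT0 _
  have hw : ∀ m : Fin n →₀ ℕ, ∏ i, ρ i ^ m i = T ^ ∑ i, a i * m i := fun m => by
    simp only [hρ, ← pow_mul, Finset.prod_pow_eq_pow_sum]
  set w : ℝ := T ^ ∑ i, a i * a i with hwa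
  have hw0 : 0 < w := pow_pos hT0 _
  have hrest : weightedNorm ρ (p - monomial a (coeff a p)) ≤ |coeff a p| * w / 2 := by
    have hsub : (p - monomial a (coeff a p)).support ⊆ p.support.erase a := by
      intro m hm
      rw [mem_support_iff, coeff_sub, coeff_monomial] at hm
      by_cases hma : a = m
      · simp [hma] at hm
      · rw [if_neg hma, sub_zero] at hm
        exact Finset.mem_erase.2 ⟨Ne.symm hma, mem_support_iff.2 hm⟩
    rw [weightedNorm_eq_sum hsub]
    have hb : ∀ m ∈ p.support.erase a, |coeff m (p - monomial a (coeff a p))| *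
        ∏ i, ρ i ^ m i ≤ |coeff m p| * (w / T) := by
      intro m hm
      obtain ⟨hma, hmp⟩ := Finset.mem_erase.1 hm
      rw [coeff_sub, coeff_monomial, if_neg (Ne.symm hma), sub_zero, hw]
      refine mul_le_mul_of_nonneg_left ?_ (abs_nonneg _)
      rw [le_div_iff₀ hT0, ← pow_succ]
      exact pow_le_pow_right₀ hT1 (hlt m hmp hma)
    refine (Finset.sum_le_sum hb).trans ?_
    rw [← Finset.sum_mul]
    have h1 : ∑ m ∈ p.support.erase a, |coeff m p| ≤ S :=
      Finset.sum_le_sum_of_subset_of_nonneg (Finset.erase_subset _ _) fun _ _ _ => abs_nonneg _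
    have h2 : 2 * S ≤ |coeff a p| * T := by
      rw [hT, mul_add, mul_div_cancel₀ _ hc.ne']
      linarith
    calc _ ≤ S * (w / T) := by gcongr
      _ = 2 * S * (w / T) / 2 := by ring
      _ ≤ |coeff a p| * T * (w / T) / 2 := by gcongr
      _ = _ := by field_simp
  refine ⟨ρ, hρ0, 2 / (|coeff a p| * w), by positivity, fun g => ?_⟩
  have hn := weightedNorm_nonneg (fun i => (hρ0 i).le) g
  have h1 : |coeff a p| * w * weightedNorm ρ g ≤
      weightedNorm ρ (p * g) + |coeff a p| * w / 2 * weightedNorm ρ g := by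
    rw [hwa, ← hw a, ← weightedNorm_monomial_mul, hw a]
    have : monomial a (coeff a p) * g = p * g - (p - monomial a (coeff a p)) * g := by ring
    rw [this]
    refine (weightedNorm_sub_le (fun i => (hρ0 i).le) _ _).trans ?_
    gcongr
    exact (weightedNorm_mul_le (fun i => (hρ0 i).le) _ _).trans (by gcongr)
  rw [div_mul_eq_mul_div, le_div_iff₀ (by positivity)]
  linarith

end WeightedNorm

section Expansion

open MvPolynomial Filter Topology

variable {n : ℕ}

/-- `U` is the expansion of `u` at the origin in homogeneous polynomials. -/
structure HasHomogeneousExpansion (u : (Fin n → ℝ) → ℝ)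
    (U : PowerSeries (MvPolynomial (Fin n) ℝ)) : Prop where
  isHomogeneous : ∀ i, (PowerSeries.coeff i U).IsHomogeneous i
  growth : ∃ C A : ℝ, 0 < C ∧ 0 < A ∧ ∀ i, weightedNorm 1 (PowerSeries.coeff i U) ≤ C * A ^ i
  hasSum : ∀ᶠ y in 𝓝 0, HasSum (fun i => eval y (PowerSeries.coeff i U)) (u y)

lemma exists_growth_of_weights {U : PowerSeries (MvPolynomial (Fin n) ℝ)}
    (hh : ∀ i, (PowerSeries.coeff i U).IsHomogeneous i)
    (hg : ∃ C A : ℝ, 0 < C ∧ 0 < A ∧ ∀ i, weightedNorm 1 (PowerSeries.coeff i U) ≤ C * A ^ i)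
    {ρ : Fin n → ℝ} (hρ : ∀ i, 0 < ρ i) :
    ∃ C A : ℝ, 0 < C ∧ 0 < A ∧ ∀ i, weightedNorm ρ (PowerSeries.coeff i U) ≤ C * A ^ i := by
  obtain ⟨C, A, hC, hA, h⟩ := hg
  set M : ℝ := 1 + ∑ i, ρ i with hM
  have hs : 0 ≤ ∑ i, ρ i := Finset.sum_nonneg fun i _ => (hρ i).le
  refine ⟨C, M * A, hC, by positivity, fun i => ?_⟩
  have h1 : ∀ i, ρ i ≤ M := fun i => by
    have := Finset.single_le_sum (f := ρ) (fun j _ => (hρ j).le) (Finset.mem_univ i)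
    linarith
  refine (weightedNorm_mono (fun i => (hρ i).le) h1 _).trans ?_
  rw [weightedNorm_const_of_isHomogeneous (hh i), mul_pow, mul_left_comm]
  gcongr
  exact h i

lemma exists_growth_of_growth_weights {U : PowerSeries (MvPolynomial (Fin n) ℝ)}
    (hh : ∀ i, (PowerSeries.coeff i U).IsHomogeneous i) {ρ : Fin n → ℝ} (hρ : ∀ i, 0 < ρ i)
    (hg : ∃ C A : ℝ, 0 < C ∧ 0 < A ∧ ∀ i, weightedNorm ρ (PowerSeries.coeff i U) ≤ C * A ^ i) :
    ∃ C A : ℝ, 0 < C ∧ 0 < A ∧ ∀ i, weightedNorm 1 (PowerSeries.coeff i U) ≤ C * A ^ i := by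
  obtain ⟨C, A, hC, hA, h⟩ := hg
  set M : ℝ := 1 + ∑ i, (ρ i)⁻¹ with hM
  have hs : 0 ≤ ∑ i, (ρ i)⁻¹ := Finset.sum_nonneg fun i _ => (inv_pos.2 (hρ i)).le
  have hM0 : 0 < M := by positivity
  refine ⟨C, M * A, hC, by positivity, fun i => ?_⟩
  have h1 : ∀ i, M⁻¹ ≤ ρ i := fun i => by
    have := Finset.single_le_sum (f := fun i => (ρ i)⁻¹) (fun j _ => (inv_pos.2 (hρ j)).le)
      (Finset.mem_univ i)
    rw [inv_le_comm₀ hM0 (hρ i)]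
    linarith
  have h2 := (weightedNorm_mono (fun i => (inv_pos.2 hM0).le) h1 _).trans (h i)
  rw [weightedNorm_const_of_isHomogeneous (hh i), inv_pow, inv_mul_le_iff₀ (by positivity)] at h2
  rw [mul_pow, mul_left_comm]
  exact h2

lemma abs_eval_coeff_le {U : PowerSeries (MvPolynomial (Fin n) ℝ)}
    (hh : ∀ i, (PowerSeries.coeff i U).IsHomogeneous i) {C A : ℝ}
    (h : ∀ i, weightedNorm 1 (PowerSeries.coeff i U) ≤ C * A ^ i) (y : Fin n → ℝ) (i : ℕ) :
    ‖eval y (PowerSeries.coeff i U)‖ ≤ C * (A * ‖y‖) ^ i := by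
  refine (abs_eval_le_of_isHomogeneous (hh i) y).trans ?_
  rw [mul_pow, ← mul_assoc]
  gcongr
  exact h i

lemma eventually_mul_norm_lt {A ε : ℝ} (hε : 0 < ε) :
    ∀ᶠ y : Fin n → ℝ in 𝓝 0, A * ‖y‖ < ε := by
  have : Continuous fun y : Fin n → ℝ => A * ‖y‖ := by fun_prop
  have h0 := this.tendsto 0
  simp only [norm_zero, mul_zero] at h0
  exact h0.eventually (gt_mem_nhds hε)

lemma eventually_summable_norm {U : PowerSeries (MvPolynomial (Fin n) ℝ)}
    (hh : ∀ i, (PowerSeries.coeff i U).IsHomogeneous i)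
    (hg : ∃ C A : ℝ, 0 < C ∧ 0 < A ∧ ∀ i, weightedNorm 1 (PowerSeries.coeff i U) ≤ C * A ^ i) :
    ∀ᶠ y in 𝓝 0, Summable fun i => ‖eval y (PowerSeries.coeff i U)‖ := by
  obtain ⟨C, A, hC, hA, h⟩ := hg
  filter_upwards [eventually_mul_norm_lt (A := A) one_pos] with y hy
  exact Summable.of_nonneg_of_le (fun _ => norm_nonneg _) (abs_eval_coeff_le hh h y)
    ((summable_geometric_of_lt_one (by positivity) hy).mul_left C)

namespace HasHomogeneousExpansion

variable {u v : (Fin n → ℝ) → ℝ} {U V : PowerSeries (MvPolynomial (Fin n) ℝ)}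

/-- Subtracting the product of an expansion with a homogeneous polynomial. -/
lemma sub_mul (hu : HasHomogeneousExpansion u U) (hv : HasHomogeneousExpansion v V) {j : ℕ}
    {F : MvPolynomial (Fin n) ℝ} (hF : F.IsHomogeneous j) :
    HasHomogeneousExpansion (fun y => u y - v y * eval y F)
      (U - V * PowerSeries.C F * PowerSeries.X ^ j) where
  isHomogeneous i := by
    rw [map_sub, PowerSeries.coeff_mul_X_pow', PowerSeries.coeff_mul_C]
    refine (hu.isHomogeneous i).sub ?_
    split_ifs with hij
    · simpa [Nat.sub_add_cancel hij] using (hv.isHomogeneous (i - j)).mul hF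
    · exact isHomogeneous_zero _ _ _
  growth := by
    obtain ⟨C, A, hC, hA, h⟩ := hu.growth
    obtain ⟨D, B, hD, hB, h'⟩ := hv.growth
    set N := weightedNorm 1 F with hN
    have hN0 : 0 ≤ N := weightedNorm_nonneg (fun _ => zero_le_one) F
    refine ⟨C + D * N, max A (max B 1), by positivity, by positivity, fun i => ?_⟩
    rw [map_sub, PowerSeries.coeff_mul_X_pow', PowerSeries.coeff_mul_C, add_mul]
    refine (weightedNorm_sub_le (fun _ => zero_le_one) _ _).trans (add_le_add ?_ ?_)
    · refine (h i).trans ?_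
      gcongr
      exact le_max_left _ _
    · split_ifs with hij
      · refine (weightedNorm_mul_le (ρ := 1) (fun _ => zero_le_one) _ _).trans ?_
        rw [mul_right_comm]
        gcongr
        refine (h' _).trans ?_
        gcongr
        calc B ^ (i - j) ≤ max A (max B 1) ^ (i - j) := by
              gcongr
              exact (le_max_left _ _).trans (le_max_right _ _)
          _ ≤ _ := pow_le_pow_right₀ ((le_max_right _ _).trans (le_max_right _ _)) (by omega)
      · rw [weightedNorm_zero]
        positivity
  hasSum := by
    filter_upwards [hu.hasSum, hv.hasSum] with y hy hy'
    simp only [map_sub, PowerSeries.coeff_mul_X_pow', PowerSeries.coeff_mul_C]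
    refine hy.sub ?_
    have h1 := hy'.mul_right (eval y F)
    rw [← Function.Injective.hasSum_iff (add_left_injective j)]
    · simpa [Function.comp_def] using h1
    · intro i hi
      have : ¬ j ≤ i := fun h => hi ⟨i - j, Nat.sub_add_cancel h⟩
      simp [this]

/-- A function is approximated by the first nonvanishing term of its expansion. -/
lemma abs_sub_eval_le (hu : HasHomogeneousExpansion u U) {m : ℕ}
    (hm : ∀ l < m, PowerSeries.coeff l U = 0) :
    ∃ C : ℝ, 0 ≤ C ∧
      ∀ᶠ y in 𝓝 0, |u y - eval y (PowerSeries.coeff m U)| ≤ C * ‖y‖ ^ (m + 1) := by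
  obtain ⟨C, A, hC, hA, h⟩ := hu.growth
  refine ⟨2 * C * A ^ (m + 1), by positivity, ?_⟩
  filter_upwards [hu.hasSum, eventually_mul_norm_lt (A := A) (half_pos one_pos)] with y hy hyA
  have hy0 : 0 ≤ A * ‖y‖ := by positivity
  have h1 := (hasSum_nat_add_iff' (m + 1)).2 hy
  rw [Finset.sum_range_succ, Finset.sum_eq_zero fun i hi => by
    rw [hm i (Finset.mem_range.1 hi), map_zero], zero_add] at h1
  have h2 : HasSum (fun i => C * (A * ‖y‖) ^ (m + 1) * (A * ‖y‖) ^ i)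
      (C * (A * ‖y‖) ^ (m + 1) * (1 - A * ‖y‖)⁻¹) :=
    (hasSum_geometric_of_lt_one hy0 (by linarith)).mul_left _
  have h3 := h1.norm_le_of_bounded h2 fun i => by
    refine (abs_eval_coeff_le hu.isHomogeneous h y _).trans (le_of_eq ?_)
    rw [add_comm i, pow_add]
    ring
  refine h3.trans ?_
  have h4 : (1 - A * ‖y‖)⁻¹ ≤ 2 := by
    rw [inv_le_comm₀ (by linarith) two_pos]
    linarith
  calc _ ≤ C * (A * ‖y‖) ^ (m + 1) * 2 := by gcongr
    _ = _ := by rw [mul_pow]; ring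

end HasHomogeneousExpansion

end Expansion

section Division

open MvPolynomial Filter Topology

variable {n : ℕ}

lemma MvPolynomial.IsHomogeneous.exists_eq_mul {k j : ℕ} {p W : MvPolynomial (Fin n) ℝ}
    (hp : p.IsHomogeneous k) (hW : W.IsHomogeneous (k + j)) (h : p ∣ W) :
    ∃ F : MvPolynomial (Fin n) ℝ, F.IsHomogeneous j ∧ W = p * F := by
  obtain ⟨q, rfl⟩ := h
  refine ⟨homogeneousComponent j q, homogeneousComponent_isHomogeneous j q, ?_⟩
  have hterm : ∀ i, homogeneousComponent (k + j) (p * homogeneousComponent i q) =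
      if i = j then p * homogeneousComponent i q else 0 := by
    intro i
    have hm : p * homogeneousComponent i q ∈ homogeneousSubmodule (Fin n) ℝ (k + i) :=
      hp.mul (homogeneousComponent_isHomogeneous i q)
    rw [homogeneousComponent_of_mem hm]
    simp [eq_comm]
  have h1 : homogeneousComponent (k + j) (p * q) = p * homogeneousComponent j q := by
    conv_lhs => rw [← sum_homogeneousComponent q, Finset.mul_sum, map_sum]
    simp only [hterm, Finset.sum_ite_eq', Finset.mem_range]
    split_ifs with hj
    · rfl
    · rw [homogeneousComponent_eq_zero _ _ (by omega), mul_zero]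
  rw [← h1, homogeneousComponent_of_mem (show p * q ∈ homogeneousSubmodule (Fin n) ℝ (k + j)
    from hW), if_pos rfl]

lemma MvPolynomial.IsHomogeneous.eq_zero_of_dvd {k m : ℕ} {p W : MvPolynomial (Fin n) ℝ}
    (hp : p.IsHomogeneous k) (hp0 : p ≠ 0) (hW : W.IsHomogeneous m) (hm : m < k) (h : p ∣ W) :
    W = 0 := by
  by_contra hW0
  obtain ⟨q, rfl⟩ := h
  have h1 := hW.totalDegree hW0
  rw [totalDegree_mul_of_isDomain hp0 (right_ne_zero_of_mul hW0), hp.totalDegree hp0] at h1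
  omega

lemma MvPolynomial.IsHomogeneous.eval_smul {k : ℕ} {p : MvPolynomial (Fin n) ℝ}
    (hp : p.IsHomogeneous k) (c : ℝ) (x : Fin n → ℝ) :
    eval (c • x) p = c ^ k * eval x p := by
  rw [eval_eq', eval_eq', Finset.mul_sum]
  refine Finset.sum_congr rfl fun m hm => ?_
  have hd : ∑ i, m i = k := by
    rw [hp.degree_eq_sum_deg_support hm, ← Finsupp.degree_apply, Finsupp.degree_eq_sum]
  simp only [Pi.smul_apply, smul_eq_mul, mul_pow, Finset.prod_mul_distrib,
    Finset.prod_pow_eq_pow_sum, hd]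
  ring

namespace HasHomogeneousExpansion

variable {u v w : (Fin n → ℝ) → ℝ} {U V W : PowerSeries (MvPolynomial (Fin n) ℝ)} {k m : ℕ}

lemma tendsto_smul_zero (x : Fin n → ℝ) :
    Tendsto (fun ε : ℝ => ε • x) (𝓝[>] 0) (𝓝 0) := by
  have : Continuous fun ε : ℝ => ε • x := by fun_prop
  simpa using (this.tendsto 0).mono_left nhdsWithin_le_nhds

/-- Along rays, a function behaves like the leading term of its expansion. -/
lemma tendsto_div_pow (hv : HasHomogeneousExpansion v V)
    (hV : ∀ l < k, PowerSeries.coeff l V = 0) (x : Fin n → ℝ) :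
    Tendsto (fun ε : ℝ => v (ε • x) / ε ^ k) (𝓝[>] 0)
      (𝓝 (eval x (PowerSeries.coeff k V))) := by
  obtain ⟨C, hC, h⟩ := hv.abs_sub_eval_le hV
  rw [tendsto_iff_norm_sub_tendsto_zero]
  have hlim : Tendsto (fun ε : ℝ => C * ‖x‖ ^ (k + 1) * ε) (𝓝[>] 0) (𝓝 0) := by
    have : Continuous fun ε : ℝ => C * ‖x‖ ^ (k + 1) * ε := by fun_prop
    simpa using (this.tendsto 0).mono_left nhdsWithin_le_nhds
  refine squeeze_zero' (Eventually.of_forall fun _ => norm_nonneg _) ?_ hlim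
  filter_upwards [(tendsto_smul_zero x).eventually h, self_mem_nhdsWithin] with ε hε hε0
  have hpos : (0 : ℝ) < ε := hε0
  rw [(hv.isHomogeneous k).eval_smul, norm_smul, Real.norm_of_nonneg hpos.le] at hε
  have heq : v (ε • x) / ε ^ k - eval x (PowerSeries.coeff k V) =
      (v (ε • x) - ε ^ k * eval x (PowerSeries.coeff k V)) / ε ^ k := by
    field_simp
  rw [heq, Real.norm_eq_abs, abs_div, abs_of_pos (pow_pos hpos k), div_le_iff₀ (pow_pos hpos k)]
  refine hε.trans (le_of_eq ?_)
  rw [mul_pow, pow_succ ε k]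
  ring

/-- If `w` vanishes on the zeros of `v` and the leading term of `v` is harmonic, then it divides
the leading term of `w`. -/
lemma leading_dvd (hv : HasHomogeneousExpansion v V) (hw : HasHomogeneousExpansion w W)
    (hV : ∀ l < k, PowerSeries.coeff l V = 0) (hW : ∀ l < m, PowerSeries.coeff l W = 0)
    (hVk : PowerSeries.coeff k V ≠ 0)
    (hharm : ∑ i, pderiv i (pderiv i (PowerSeries.coeff k V)) = 0)
    (hvc : ∀ᶠ y in 𝓝 0, ContinuousAt v y) (hvw : ∀ᶠ y in 𝓝 0, v y = 0 → w y = 0) :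
    PowerSeries.coeff k V ∣ PowerSeries.coeff m W := by
  refine dvd_of_eval_eq_zero_of_signChange (hv.isHomogeneous k) hharm hVk fun z hz1 hz2 => ?_
  by_contra hz
  set q := PowerSeries.coeff m W with hq
  set c := |eval z q| / 2 with hc
  have hc0 : 0 < c := by positivity
  have hev : ∀ᶠ y in 𝓝 z, c < |eval y q| :=
    (continuous_eval_real q).abs.continuousAt.eventually_const_lt (by
      rw [hc]; linarith [abs_pos.2 hz])
  obtain ⟨r, hr, hball⟩ := Metric.eventually_nhds_iff_ball.1 hev
  obtain ⟨x, hx, hxb⟩ := (hz1.and_eventually (Metric.ball_mem_nhds z hr)).exists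
  obtain ⟨y, hy, hyb⟩ := (hz2.and_eventually (Metric.ball_mem_nhds z hr)).exists
  obtain ⟨C, hC, hasym⟩ := hw.abs_sub_eval_le hW
  have hnear := hasym.and (hvc.and hvw)
  obtain ⟨δ, hδ, hδball⟩ := Metric.eventually_nhds_iff_ball.1 hnear
  set M := ‖z‖ + r with hM
  have hM0 : 0 < M := by positivity
  have hnorm : ∀ x' ∈ Metric.ball z r, ‖x'‖ ≤ M := fun x' hx' => by
    have h1 : ‖x' - z‖ < r := by simpa [dist_eq_norm] using hx'
    have h2 : ‖x'‖ ≤ ‖x' - z‖ + ‖z‖ := by simpa using norm_add_le (x' - z) z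
    rw [hM]; linarith
  have e1 : ∀ᶠ ε : ℝ in 𝓝[>] 0, 0 < v (ε • x) := by
    filter_upwards [(hv.tendsto_div_pow hV x).eventually (lt_mem_nhds hx), self_mem_nhdsWithin]
      with ε hε hε0
    exact (div_pos_iff_of_pos_right (pow_pos hε0 k)).1 hε
  have e2 : ∀ᶠ ε : ℝ in 𝓝[>] 0, v (ε • y) < 0 := by
    filter_upwards [(hv.tendsto_div_pow hV y).eventually (gt_mem_nhds hy), self_mem_nhdsWithin]
      with ε hε hε0
    have := (div_lt_iff₀ (pow_pos hε0 k)).1 hε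
    simpa using this
  have e3 : ∀ᶠ ε : ℝ in 𝓝[>] 0, ε * M < δ := by
    have hcont : Continuous fun ε : ℝ => ε * M := by fun_prop
    refine ((hcont.tendsto 0).mono_left nhdsWithin_le_nhds).eventually (gt_mem_nhds ?_)
    simpa using hδ
  have e4 : ∀ᶠ ε : ℝ in 𝓝[>] 0, ε * (C * M ^ (m + 1)) < c := by
    have hcont : Continuous fun ε : ℝ => ε * (C * M ^ (m + 1)) := by fun_prop
    refine ((hcont.tendsto 0).mono_left nhdsWithin_le_nhds).eventually (gt_mem_nhds ?_)
    simpa using hc0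
  obtain ⟨ε, hε1, hε2, hε3, hε4, hε0⟩ :=
    (e1.and (e2.and (e3.and (e4.and self_mem_nhdsWithin)))).exists
  have hεpos : (0 : ℝ) < ε := hε0
  have hseg : segment ℝ x y ⊆ Metric.ball z r := (convex_ball z r).segment_subset hxb hyb
  have hmem : ∀ x' ∈ Metric.ball z r, ε • x' ∈ Metric.ball (0 : Fin n → ℝ) δ := fun x' hx' => by
    rw [mem_ball_zero_iff, norm_smul, Real.norm_of_nonneg hεpos.le]
    exact (mul_le_mul_of_nonneg_left (hnorm x' hx') hεpos.le).trans_lt hε3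
  have hcont : ContinuousOn (fun x' => v (ε • x')) (segment ℝ x y) := fun x' hx' => by
    have h1 : ContinuousAt v (ε • x') := (hδball _ (hmem x' (hseg hx'))).2.1
    have h2 : ContinuousAt (fun x' : Fin n → ℝ => ε • x') x' := by fun_prop
    exact (ContinuousAt.comp (g := v) (f := fun x' : Fin n → ℝ => ε • x') h1
      h2).continuousWithinAt
  obtain ⟨s, hs, hs0⟩ := (convex_segment x y).isPreconnected.intermediate_value
    (right_mem_segment ℝ x y) (left_mem_segment ℝ x y) hcont ⟨hε2.le, hε1.le⟩
  obtain ⟨h1, -, h2⟩ := hδball _ (hmem s (hseg hs))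
  rw [h2 hs0, zero_sub, abs_neg, (hw.isHomogeneous m).eval_smul, abs_mul,
    abs_of_pos (pow_pos hεpos m), norm_smul, Real.norm_of_nonneg hεpos.le] at h1
  have h3 : ε ^ m * c < ε ^ m * (ε * (C * M ^ (m + 1))) := by
    calc ε ^ m * c < ε ^ m * |eval s q| := by gcongr; exact hball s (hseg hs)
      _ ≤ C * (ε * ‖s‖) ^ (m + 1) := h1
      _ ≤ C * (ε * M) ^ (m + 1) := by gcongr; exact hnorm s (hseg hs)
      _ = _ := by rw [mul_pow, pow_succ ε m]; ring
  exact absurd (lt_of_mul_lt_mul_left h3 (by positivity)) (not_lt.2 hε4.le)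

end HasHomogeneousExpansion

end Division

section Quotient

open MvPolynomial Filter Topology

/-- A discrete Grönwall inequality with geometric kernel. -/
lemma le_mul_pow_of_le_add_sum {x : ℕ → ℝ} {A K : ℝ} (hA : 0 ≤ A) (hK : 0 ≤ K)
    (h : ∀ j, x j ≤ K * (A ^ j + ∑ b ∈ Finset.range j, A ^ (j - b) * x b)) (j : ℕ) :
    x j ≤ K * (A * (1 + K)) ^ j := by
  set T : ℕ → ℝ := fun j => A ^ j + ∑ b ∈ Finset.range j, A ^ (j - b) * x b with hT
  have hstep : ∀ j, T (j + 1) = A * (T j + x j) := by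
    intro j
    simp only [hT, Finset.sum_range_succ, mul_add, Finset.mul_sum]
    rw [Nat.add_sub_cancel_left, pow_one, pow_succ', add_assoc]
    congr 2
    refine Finset.sum_congr rfl fun b hb => ?_
    rw [Nat.sub_add_comm (Finset.mem_range.1 hb).le, pow_succ', mul_assoc]
  have hbound : ∀ j, T j ≤ (A * (1 + K)) ^ j := by
    intro j
    induction j with
    | zero => simp [hT]
    | succ j ih =>
      rw [hstep, pow_succ']
      calc A * (T j + x j) ≤ A * (T j + K * T j) := by gcongr; exact h j
        _ = A * (1 + K) * T j := by ring
        _ ≤ _ := by gcongr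
  exact (h j).trans (by gcongr; exact hbound j)

namespace HasHomogeneousExpansion

variable {n k : ℕ} {u v : (Fin n → ℝ) → ℝ} {U V : PowerSeries (MvPolynomial (Fin n) ℝ)}

/-- Formal division of expansions by an expansion whose leading form is harmonic. -/
lemma exists_eq_mul (hu : HasHomogeneousExpansion u U) (hv : HasHomogeneousExpansion v V)
    (hV : ∀ l < k, PowerSeries.coeff l V = 0) (hVk : PowerSeries.coeff k V ≠ 0)
    (hharm : ∑ i, pderiv i (pderiv i (PowerSeries.coeff k V)) = 0)
    (hvc : ∀ᶠ y in 𝓝 0, ContinuousAt v y) (hvu : ∀ᶠ y in 𝓝 0, v y = 0 → u y = 0) :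
    ∃ G : PowerSeries (MvPolynomial (Fin n) ℝ),
      (∀ i, (PowerSeries.coeff i G).IsHomogeneous i) ∧ U = V * G := by
  let P : ℕ → PowerSeries (MvPolynomial (Fin n) ℝ) → Prop := fun j G =>
    (∀ i, (PowerSeries.coeff i G).IsHomogeneous i) ∧
    (∀ l < k + j, PowerSeries.coeff l (U - V * G) = 0) ∧
    ∃ w, HasHomogeneousExpansion w (U - V * G) ∧ ∀ᶠ y in 𝓝 0, v y = 0 → w y = 0
  have hbase : P 0 0 := by
    refine ⟨fun i => by rw [map_zero]; exact isHomogeneous_zero _ _ _, ?_, u, by simpa using hu,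
      hvu⟩
    intro l
    induction l using Nat.strong_induction_on with
    | _ l ih =>
      intro hl
      rw [mul_zero, sub_zero] at ih ⊢
      exact (hv.isHomogeneous k).eq_zero_of_dvd hVk (hu.isHomogeneous l) hl
        (leading_dvd hv hu hV (fun i hi => ih i hi (hi.trans hl)) hVk hharm hvc hvu)
  have hstep : ∀ j G, P j G → ∃ G', P (j + 1) G' ∧
      ∀ i, i ≠ j → PowerSeries.coeff i G' = PowerSeries.coeff i G := by
    rintro j G ⟨hG, hW, w, hw, hvw⟩
    obtain ⟨F, hF, hFW⟩ := (hv.isHomogeneous k).exists_eq_mul (hw.isHomogeneous (k + j))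
      (leading_dvd hv hw hV hW hVk hharm hvc hvw)
    have hcoeff : ∀ i, PowerSeries.coeff i (PowerSeries.C F * PowerSeries.X ^ j) =
        if i = j then F else 0 := by
      intro i
      rw [PowerSeries.coeff_C_mul, PowerSeries.coeff_X_pow]
      split_ifs <;> simp
    have heq : U - V * (G + PowerSeries.C F * PowerSeries.X ^ j) =
        (U - V * G) - V * PowerSeries.C F * PowerSeries.X ^ j := by ring
    refine ⟨G + PowerSeries.C F * PowerSeries.X ^ j, ⟨fun i => ?_, fun l hl => ?_,
      fun y => w y - v y * eval y F, ?_, ?_⟩, fun i hi => ?_⟩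
    · rw [map_add, hcoeff]
      refine (hG i).add ?_
      split_ifs with h
      · exact h ▸ hF
      · exact isHomogeneous_zero _ _ _
    · rw [heq, map_sub, PowerSeries.coeff_mul_X_pow', PowerSeries.coeff_mul_C]
      rcases (show l < k + j ∨ l = k + j by omega) with h | rfl
      · rw [hW l h, zero_sub, neg_eq_zero]
        split_ifs with hj
        · rw [hV _ (by omega), zero_mul]
        · rfl
      · rw [hFW, if_pos (by omega), Nat.add_sub_cancel, sub_self]
    · rw [heq]
      exact hw.sub_mul hv hF
    · filter_upwards [hvw] with y hy h0
      simp [hy h0, h0]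
    · rw [map_add, hcoeff, if_neg hi, add_zero]
  choose! extend hextend hextend' using hstep
  let Gs : ℕ → PowerSeries (MvPolynomial (Fin n) ℝ) := fun j => Nat.rec 0 extend j
  have hP : ∀ j, P j (Gs j) := fun j => by
    induction j with
    | zero => exact hbase
    | succ j ih => exact hextend j _ ih
  have hstable : ∀ i j, i + 1 ≤ j →
      PowerSeries.coeff i (Gs j) = PowerSeries.coeff i (Gs (i + 1)) := by
    intro i j hij
    induction j, hij using Nat.le_induction with
    | base => rfl
    | succ j hj ih => exact (hextend' j _ (hP j) i (by omega)).trans ih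
  refine ⟨PowerSeries.mk fun i => PowerSeries.coeff i (Gs (i + 1)), fun i => ?_, ?_⟩
  · rw [PowerSeries.coeff_mk]
    exact (hP (i + 1)).1 i
  · ext1 l
    have h := (hP (l + 1)).2.1 l (by omega)
    rw [map_sub, sub_eq_zero] at h
    rw [h, PowerSeries.coeff_mul, PowerSeries.coeff_mul]
    refine Finset.sum_congr rfl fun ij hij => ?_
    have hle := Finset.HasAntidiagonal.mem_antidiagonal.1 hij
    rw [PowerSeries.coeff_mk, hstable ij.2 (l + 1) (by omega)]

/-- The formal quotient of two convergent expansions converges. -/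
lemma growth_of_eq_mul (hu : HasHomogeneousExpansion u U) (hv : HasHomogeneousExpansion v V)
    (hV : ∀ l < k, PowerSeries.coeff l V = 0) (hVk : PowerSeries.coeff k V ≠ 0)
    {G : PowerSeries (MvPolynomial (Fin n) ℝ)}
    (hG : ∀ i, (PowerSeries.coeff i G).IsHomogeneous i) (hUG : U = V * G) :
    ∃ C A : ℝ, 0 < C ∧ 0 < A ∧ ∀ i, weightedNorm 1 (PowerSeries.coeff i G) ≤ C * A ^ i := by
  obtain ⟨ρ, hρ, K, hK, hdiv⟩ := exists_weightedNorm_le_mul hVk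
  refine exists_growth_of_growth_weights hG hρ ?_
  obtain ⟨C, A, hC, hA, hCA⟩ := exists_growth_of_weights hu.isHomogeneous hu.growth hρ
  obtain ⟨D, B, hD, hB, hDB⟩ := exists_growth_of_weights hv.isHomogeneous hv.growth hρ
  have hρ' : ∀ i, 0 ≤ ρ i := fun i => (hρ i).le
  set M := max A B with hM
  have hM0 : 0 < M := lt_max_of_lt_left hA
  set E := max C D with hE
  have hE0 : 0 < E := lt_max_of_lt_left hC
  have hrec : ∀ j, PowerSeries.coeff k V * PowerSeries.coeff j G =
      PowerSeries.coeff (k + j) U -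
        ∑ b ∈ Finset.range j, PowerSeries.coeff (k + j - b) V * PowerSeries.coeff b G := by
    intro j
    rw [eq_sub_iff_add_eq, hUG, PowerSeries.coeff_mul,
      ← Finset.Nat.sum_antidiagonal_swap, Finset.Nat.sum_antidiagonal_eq_sum_range_succ_mk,
      ← Finset.sum_subset (Finset.range_subset_range.2 (show j + 1 ≤ (k + j).succ by omega)),
      Finset.sum_range_succ, add_comm]
    · simp
    · intro b hbk hb
      rw [Finset.mem_range] at hb hbk
      simp only [Prod.swap_prod_mk]
      rw [hV _ (by omega), zero_mul]
  have hbound : ∀ j, weightedNorm ρ (PowerSeries.coeff j G) ≤ K * E * M ^ k *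
      (M ^ j + ∑ b ∈ Finset.range j, M ^ (j - b) * weightedNorm ρ (PowerSeries.coeff b G)) := by
    intro j
    refine (hdiv _).trans ?_
    rw [mul_assoc K, mul_assoc K, hrec]
    gcongr
    refine (weightedNorm_sub_le hρ' _ _).trans ?_
    rw [mul_add]
    gcongr
    · refine (hCA _).trans ?_
      rw [mul_assoc, ← pow_add]
      gcongr
      · exact le_max_left _ _
      · exact le_max_left _ _
    · refine (weightedNorm_sum_le hρ' _ _).trans ?_
      rw [Finset.mul_sum]
      refine Finset.sum_le_sum fun b hb => ?_
      have hb' := Finset.mem_range.1 hb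
      refine (weightedNorm_mul_le hρ' _ _).trans ?_
      rw [← mul_assoc]
      refine mul_le_mul_of_nonneg_right ?_ (weightedNorm_nonneg hρ' _)
      refine (hDB _).trans ?_
      rw [mul_assoc, ← pow_add, Nat.add_sub_assoc hb'.le]
      gcongr
      · exact le_max_right _ _
      · exact le_max_right _ _
  have hmain := le_mul_pow_of_le_add_sum hM0.le (by positivity) hbound
  refine ⟨K * E * M ^ k + 1, M * (1 + K * E * M ^ k), by positivity, by positivity, fun i => ?_⟩
  refine (hmain i).trans ?_
  gcongr
  linarith

/-- Division of convergent expansions by an expansion whose leading form is harmonic. -/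
lemma exists_quotient (hu : HasHomogeneousExpansion u U) (hv : HasHomogeneousExpansion v V)
    (hV : ∀ l < k, PowerSeries.coeff l V = 0) (hVk : PowerSeries.coeff k V ≠ 0)
    (hharm : ∑ i, pderiv i (pderiv i (PowerSeries.coeff k V)) = 0)
    (hvc : ∀ᶠ y in 𝓝 0, ContinuousAt v y) (hvu : ∀ᶠ y in 𝓝 0, v y = 0 → u y = 0) :
    ∃ f G, HasHomogeneousExpansion f G ∧ ∀ᶠ y in 𝓝 0, u y = v y * f y := by
  obtain ⟨G, hG, hUG⟩ := exists_eq_mul hu hv hV hVk hharm hvc hvu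
  have hgrowth := growth_of_eq_mul hu hv hV hVk hG hUG
  refine ⟨fun y => ∑' i, eval y (PowerSeries.coeff i G), G, ⟨hG, hgrowth, ?_⟩, ?_⟩
  · filter_upwards [eventually_summable_norm hG hgrowth] with y hy
    exact hy.of_norm.hasSum
  · filter_upwards [eventually_summable_norm hG hgrowth,
      eventually_summable_norm hv.isHomogeneous hv.growth, hu.hasSum, hv.hasSum]
      with y hy1 hy2 hy3 hy4
    rw [← hy3.tsum_eq, ← hy4.tsum_eq,
      tsum_mul_tsum_eq_tsum_sum_antidiagonal_of_summable_norm hy2 hy1]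
    refine tsum_congr fun i => ?_
    rw [hUG, PowerSeries.coeff_mul, map_sum]
    simp only [map_mul]

end HasHomogeneousExpansion

end Quotient

section AnalyticExpansion

open MvPolynomial Filter Topology

variable {n : ℕ}

/-- A continuous multilinear map induces a homogeneous polynomial on the diagonal. -/
lemma ContinuousMultilinearMap.exists_isHomogeneous_eval_eq {i : ℕ}
    (P : ContinuousMultilinearMap ℝ (fun _ : Fin i => Fin n → ℝ) ℝ) :
    ∃ p : MvPolynomial (Fin n) ℝ, p.IsHomogeneous i ∧ weightedNorm 1 p ≤ (n : ℝ) ^ i * ‖P‖ ∧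
      ∀ y, eval y p = P fun _ => y := by
  classical
  have hmon : ∀ f : Fin i → Fin n, (C (P fun j => Pi.single (f j) 1) * ∏ j, X (f j) :
      MvPolynomial (Fin n) ℝ) =
      monomial (∑ j, Finsupp.single (f j) 1) (P fun j => Pi.single (f j) 1) := by
    intro f
    rw [← mul_one (P fun j => Pi.single (f j) 1), ← C_mul_monomial, monomial_sum_one]
    simp [X]
  refine ⟨∑ f : Fin i → Fin n, C (P fun j => Pi.single (f j) 1) * ∏ j, X (f j), ?_, ?_, ?_⟩
  · refine IsHomogeneous.sum _ _ _ fun f _ => ?_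
    simpa using (isHomogeneous_C (Fin n) (P fun j => Pi.single (f j) (1 : ℝ))).mul
      (IsHomogeneous.prod Finset.univ (fun j => (X (f j) : MvPolynomial (Fin n) ℝ)) (fun _ => 1)
        fun j _ => isHomogeneous_X ℝ (f j))
  · refine (weightedNorm_sum_le (fun _ => zero_le_one) _ _).trans ?_
    have hterm : ∀ f : Fin i → Fin n, weightedNorm 1
        (C (P fun j => Pi.single (f j) 1) * ∏ j, X (f j) : MvPolynomial (Fin n) ℝ) ≤ ‖P‖ := by
      intro f
      rw [hmon, weightedNorm_eq_sum support_monomial_subset]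
      simpa [Pi.norm_single] using P.le_opNorm fun j => Pi.single (f j) (1 : ℝ)
    refine (Finset.sum_le_card_nsmul _ _ _ fun f _ => hterm f).trans ?_
    simp
  · intro y
    have hy : y = ∑ k, y k • (Pi.single k 1 : Fin n → ℝ) := by
      ext k
      simp [Pi.single_apply]
    conv_rhs => rw [hy]
    have h := P.toMultilinearMap.map_sum (fun (_ : Fin i) (k : Fin n) =>
      y k • (Pi.single k 1 : Fin n → ℝ))
    rw [ContinuousMultilinearMap.coe_coe] at h
    rw [h, _root_.map_sum]
    refine Finset.sum_congr rfl fun f _ => ?_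
    rw [P.map_smul_univ (fun j => y (f j)) (fun j => Pi.single (f j) (1 : ℝ))]
    simp [mul_comm]

/-- Analytic functions expand into homogeneous polynomials. -/
lemma AnalyticAt.exists_hasHomogeneousExpansion {u : (Fin n → ℝ) → ℝ} (hu : AnalyticAt ℝ u 0) :
    ∃ U, HasHomogeneousExpansion u U := by
  obtain ⟨P, hP⟩ := hu
  choose p hp hpn hpe using fun i => (P i).exists_isHomogeneous_eval_eq
  obtain ⟨C, r, hC, hr, hCr⟩ := P.le_mul_pow_of_radius_pos hP.radius_pos
  refine ⟨PowerSeries.mk p, fun i => by simpa using hp i, ⟨C, (n + 1) * r, hC, by positivity,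
    fun i => ?_⟩, ?_⟩
  · rw [PowerSeries.coeff_mk, mul_pow, mul_left_comm]
    refine (hpn i).trans ?_
    gcongr
    · linarith
    · exact hCr i
  · obtain ⟨R, hR⟩ := hP
    filter_upwards [Metric.eball_mem_nhds 0 hR.r_pos] with y hy
    simpa [hpe] using hR.hasSum hy

/-- A monomial of degree `j` is the diagonal of a multilinear map of norm at most one. -/
lemma exists_continuousMultilinearMap_monomial {j : ℕ} {m : Fin n →₀ ℕ} (hm : m.degree = j) :
    ∃ Q : ContinuousMultilinearMap ℝ (fun _ : Fin j => Fin n → ℝ) ℝ,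
      ‖Q‖ ≤ 1 ∧ ∀ y, Q (fun _ => y) = ∏ i, y i ^ m i := by
  obtain ⟨l, hl⟩ : ∃ l : Fin j → Fin n, ∀ y : Fin n → ℝ, ∏ t, y (l t) = ∏ i, y i ^ m i := by
    obtain ⟨L, hL⟩ : ∃ L : List (Fin n), (L : Multiset (Fin n)) = Finsupp.toMultiset m :=
      Quot.exists_rep _
    have hlen : L.length = j := by
      have h := congrArg Multiset.card hL
      rw [Finsupp.card_toMultiset] at h
      rw [← hm]
      exact h
    subst hlen
    refine ⟨L.get, fun y => ?_⟩
    have h := congrArg (fun s => (Multiset.map y s).prod) hL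
    simp only [Finset.prod_multiset_map_count, Finsupp.toFinset_toMultiset,
      Finsupp.count_toMultiset] at h
    rw [← Finset.prod_subset (Finset.subset_univ m.support) fun i _ hi => by
      rw [Finsupp.notMem_support_iff.1 hi, pow_zero], ← h, ← Finset.prod_multiset_map_count,
      Multiset.map_coe, Multiset.prod_coe, ← Fin.prod_univ_fun_getElem]
    rfl
  refine ⟨(ContinuousMultilinearMap.mkPiAlgebra ℝ (Fin j) ℝ).compContinuousLinearMap
    fun t => ContinuousLinearMap.proj (l t), ?_, fun y => by simpa using hl y⟩
  refine ContinuousMultilinearMap.opNorm_le_bound zero_le_one fun v => ?_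
  simp only [ContinuousMultilinearMap.compContinuousLinearMap_apply,
    ContinuousMultilinearMap.mkPiAlgebra_apply, one_mul, norm_prod]
  exact Finset.prod_le_prod (fun _ _ => norm_nonneg _) fun t _ => norm_le_pi_norm (v t) (l t)

/-- A homogeneous polynomial is the diagonal of a multilinear map. -/
lemma MvPolynomial.IsHomogeneous.exists_continuousMultilinearMap {j : ℕ}
    {p : MvPolynomial (Fin n) ℝ} (hp : p.IsHomogeneous j) :
    ∃ Q : ContinuousMultilinearMap ℝ (fun _ : Fin j => Fin n → ℝ) ℝ,
      ‖Q‖ ≤ weightedNorm 1 p ∧ ∀ y, Q (fun _ => y) = eval y p := by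
  have h : ∀ m ∈ p.support, ∃ Q : ContinuousMultilinearMap ℝ (fun _ : Fin j => Fin n → ℝ) ℝ,
      ‖Q‖ ≤ 1 ∧ ∀ y, Q (fun _ => y) = ∏ i, y i ^ m i := fun m hm =>
    exists_continuousMultilinearMap_monomial
      (by rw [Finsupp.degree_eq_weight_one]; exact hp (mem_support_iff.1 hm))
  choose! Q hQ1 hQ2 using h
  refine ⟨∑ m ∈ p.support, coeff m p • Q m, ?_, fun y => ?_⟩
  · refine norm_sum_le_of_le _ fun m hm => ?_
    rw [norm_smul]
    simpa using mul_le_of_le_one_right (abs_nonneg (coeff m p)) (hQ1 m hm)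
  · rw [eval_eq', _root_.sum_apply]
    refine Finset.sum_congr rfl fun m hm => ?_
    rw [_root_.smul_apply, hQ2 m hm, smul_eq_mul]

/-- A function with an expansion into homogeneous polynomials is analytic. -/
lemma HasHomogeneousExpansion.analyticAt {u : (Fin n → ℝ) → ℝ}
    {U : PowerSeries (MvPolynomial (Fin n) ℝ)} (hu : HasHomogeneousExpansion u U) :
    AnalyticAt ℝ u 0 := by
  choose Q hQ1 hQ2 using fun i => (hu.isHomogeneous i).exists_continuousMultilinearMap
  obtain ⟨C, A, hC, hA, h⟩ := hu.growth
  obtain ⟨r, hr, hball⟩ := EMetric.mem_nhds_iff.1 hu.hasSum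
  have hrad : (Real.toNNReal A⁻¹ : ENNReal) ≤
      FormalMultilinearSeries.radius (fun i => Q i) := by
    refine FormalMultilinearSeries.le_radius_of_bound _ C fun i => ?_
    rw [Real.coe_toNNReal _ (by positivity), inv_pow, mul_inv_le_iff₀ (by positivity)]
    exact (hQ1 i).trans (h i)
  refine ⟨fun i => Q i, min (Real.toNNReal A⁻¹ : ENNReal) r,
    (min_le_left _ _).trans hrad, lt_min ?_ hr, fun {y} hy => ?_⟩
  · rw [ENNReal.coe_pos]
    exact Real.toNNReal_pos.2 (inv_pos.2 hA)
  · simpa [hQ2] using hball (Metric.eball_subset_eball (min_le_right _ _) hy)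

end AnalyticExpansion

section LeadingForm

open MvPolynomial Filter Topology MeasureTheory Metric Set

variable {n k : ℕ}

lemma HasMeanValue.mono {φ f : (Fin n → ℝ) → ℝ} {s t : Set (Fin n → ℝ)}
    (hf : HasMeanValue volume φ f t) (hst : s ⊆ t) : HasMeanValue volume φ f s :=
  ⟨hf.continuousOn.mono hst, fun x r hr h => hf.average x r hr (h.trans hst)⟩

lemma HasMeanValue.sub {φ f g : (Fin n → ℝ) → ℝ} {s : Set (Fin n → ℝ)}
    (hf : HasMeanValue volume φ f s) (hφ : IsAveragingKernel volume φ)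
    (hg : HasMeanValue volume φ g s) : HasMeanValue volume φ (fun y => f y - g y) s := by
  refine ⟨hf.continuousOn.sub hg.continuousOn, fun x r hr h => ?_⟩
  simp only [smul_sub]
  rw [integral_sub, hf.average x r hr h, hg.average x r hr h]
  · exact integrable_smul_of_eq_zero hφ.contDiff.continuous hφ.eq_zero
      (continuousOn_comp_add_smul hf.continuousOn hr.le h)
  · exact integrable_smul_of_eq_zero hφ.contDiff.continuous hφ.eq_zero
      (continuousOn_comp_add_smul hg.continuousOn hr.le h)

/-- Translates of harmonic functions are harmonic. -/
lemma IsHarmonicOn.comp_add_left {v : (Fin n → ℝ) → ℝ} {s : Set (Fin n → ℝ)}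
    (hv : IsHarmonicOn v s) (a : Fin n → ℝ) :
    IsHarmonicOn (fun y => v (a + y)) ((fun y => a + y) ⁻¹' s) := by
  refine ⟨hv.1.comp (by fun_prop) fun _ hy => hy, fun x hx => ?_⟩
  simp only [iteratedFDeriv_comp_add_left]
  exact hv.2 (a + x) hx

lemma IsHarmonicOn.analyticAt {v : (Fin n → ℝ) → ℝ} {s : Set (Fin n → ℝ)}
    (hv : IsHarmonicOn v s) (hs : IsOpen s) {x : Fin n → ℝ} (hx : x ∈ s) : AnalyticAt ℝ v x :=
  (hv.hasMeanValue hs).analyticAt isAveragingKernel_radialBump hs hx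

/-- A homogeneous polynomial of degree at most one is harmonic. -/
lemma MvPolynomial.IsHomogeneous.pderiv_pderiv_eq_zero {p : MvPolynomial (Fin n) ℝ}
    (hp : p.IsHomogeneous k) (hk : k ≤ 1) (i : Fin n) : pderiv i (pderiv i p) = 0 := by
  have h : (pderiv i p).IsHomogeneous 0 := by
    have := hp.pderiv (i := i)
    rwa [Nat.sub_eq_zero_of_le hk] at this
  rw [totalDegree_eq_zero_iff_eq_C.1 (Nat.le_zero.1 h.totalDegree_le), pderiv_C]

namespace HasHomogeneousExpansion

variable {φ v : (Fin n → ℝ) → ℝ} {V : PowerSeries (MvPolynomial (Fin n) ℝ)}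
  {s : Set (Fin n → ℝ)}

/-- The leading form of a function with the mean value property has the mean value property. -/
lemma hasMeanValue_leading (hφ : IsAveragingKernel volume φ) (hv : HasHomogeneousExpansion v V)
    (hV : ∀ l < k, PowerSeries.coeff l V = 0) (hs : s ∈ 𝓝 0) (hm : HasMeanValue volume φ v s) :
    HasMeanValue volume φ (fun y => eval y (PowerSeries.coeff k V)) univ := by
  set p := PowerSeries.coeff k V with hp
  refine ⟨(continuous_eval_real p).continuousOn, fun x r hr _ => ?_⟩
  obtain ⟨C, hC, hest⟩ := hv.abs_sub_eval_le hV
  obtain ⟨δ, hδ, hball⟩ := Metric.mem_nhds_iff.1 (inter_mem hs hest)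
  set N := ‖x‖ + r with hN
  have hN0 : 0 < N := by positivity
  set I := ∫ y, |φ y| with hI
  have hφc := hφ.contDiff.continuous
  have hmem : ∀ ε : ℝ, 0 < ε → ε < δ / N → ∀ z ∈ closedBall (ε • x) (ε * r),
      z ∈ ball (0 : Fin n → ℝ) δ ∧ ‖z‖ ≤ ε * N := by
    intro ε hε hεδ z hz
    have h1 : ‖z‖ ≤ ε * N := by
      have h2 := norm_le_norm_add_norm_sub' z (ε • x)
      rw [mem_closedBall, dist_eq_norm] at hz
      rw [norm_smul, Real.norm_of_nonneg hε.le] at h2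
      rw [hN, mul_add]
      linarith
    refine ⟨?_, h1⟩
    rw [mem_ball_zero_iff]
    exact h1.trans_lt ((lt_div_iff₀ hN0).1 hεδ)
  have key : ∀ ε : ℝ, 0 < ε → ε < δ / N →
      ‖(∫ y, φ y • eval (x + r • y) p) - eval x p‖ ≤ (C * N ^ (k + 1) * (1 + I)) * ε := by
    intro ε hε hεδ
    have hsub : closedBall (ε • x) (ε * r) ⊆ s := fun z hz =>
      (hball (hmem ε hε hεδ z hz).1).1
    have hbd : ∀ z ∈ closedBall (ε • x) (ε * r), |v z - eval z p| ≤ C * (ε * N) ^ (k + 1) := by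
      intro z hz
      refine (hball (hmem ε hε hεδ z hz).1).2.trans ?_
      gcongr
      exact (hmem ε hε hεδ z hz).2
    have hav := hm.average (ε • x) (ε * r) (by positivity) hsub
    have hint1 : Integrable fun y => φ y • v (ε • x + (ε * r) • y) :=
      integrable_smul_of_eq_zero hφc hφ.eq_zero
        (continuousOn_comp_add_smul hm.continuousOn (by positivity) hsub)
    have hint2 : Integrable fun y => φ y • eval (ε • x + (ε * r) • y) p :=
      integrable_smul_of_eq_zero hφc hφ.eq_zero
        (continuousOn_comp_add_smul (continuous_eval_real p).continuousOn (by positivity)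
          (subset_univ _))
    have hscale : ∀ y, eval (ε • x + (ε * r) • y) p = ε ^ k * eval (x + r • y) p := by
      intro y
      rw [← (hv.isHomogeneous k).eval_smul, smul_add, smul_smul]
    have h1 : ∫ y, φ y • eval (ε • x + (ε * r) • y) p =
        ε ^ k * ∫ y, φ y • eval (x + r • y) p := by
      rw [← integral_const_mul]
      refine integral_congr_ae (Eventually.of_forall fun y => ?_)
      simp only [hscale, smul_eq_mul]
      ring
    have h2 : ‖∫ y, φ y • (v (ε • x + (ε * r) • y) - eval (ε • x + (ε * r) • y) p)‖ ≤
        I * (C * (ε * N) ^ (k + 1)) := by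
      rw [hI, ← integral_mul_const]
      refine norm_integral_le_of_norm_le ((hφc.abs.integrable_of_hasCompactSupport
        hφ.hasCompactSupport.norm).mul_const _) (Eventually.of_forall fun y => ?_)
      rw [norm_smul, Real.norm_eq_abs]
      by_cases hy : ‖y‖ ≤ 1
      · gcongr
        exact hbd _ (add_smul_mem_closedBall (by positivity) hy)
      · simp [hφ.eq_zero y (not_le.1 hy)]
    simp only [smul_sub] at h2
    rw [integral_sub hint1 hint2, hav, h1] at h2
    have h3 := hbd (ε • x) (mem_closedBall_self (by positivity))
    rw [(hv.isHomogeneous k).eval_smul] at h3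
    have h4 : ε ^ k * ‖(∫ y, φ y • eval (x + r • y) p) - eval x p‖ ≤
        (1 + I) * (C * (ε * N) ^ (k + 1)) := by
      rw [← abs_of_pos (pow_pos hε k), ← Real.norm_eq_abs, ← norm_mul, mul_sub, add_mul, one_mul]
      refine le_trans ?_ (add_le_add h3 h2)
      rw [← Real.norm_eq_abs]
      refine le_trans (le_of_eq ?_) (norm_sub_le _ _)
      congr 1
      ring
    refine le_of_mul_le_mul_left (h4.trans (le_of_eq ?_)) (pow_pos hε k)
    rw [mul_pow, pow_succ ε k]
    ring
  have hlim : Tendsto (fun ε : ℝ => (C * N ^ (k + 1) * (1 + I)) * ε) (𝓝[>] 0) (𝓝 0) := by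
    have : Continuous fun ε : ℝ => (C * N ^ (k + 1) * (1 + I)) * ε := by fun_prop
    simpa using (this.tendsto 0).mono_left nhdsWithin_le_nhds
  have hle := ge_of_tendsto hlim (by
    filter_upwards [Ioo_mem_nhdsGT (div_pos hδ hN0)] with ε hε
    exact key ε hε.1 hε.2)
  exact sub_eq_zero.1 (norm_le_zero_iff.1 hle)

/-- The leading form of a harmonic function is harmonic. -/
lemma laplacian_leading_eq_zero (hv : HasHomogeneousExpansion v V)
    (hV : ∀ l < k, PowerSeries.coeff l V = 0) (hs : IsOpen s) (h0 : (0 : Fin n → ℝ) ∈ s)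
    (hharm : IsHarmonicOn v s) :
    ∑ i, pderiv i (pderiv i (PowerSeries.coeff k V)) = 0 := by
  set p := PowerSeries.coeff k V with hp
  have hpk : p.IsHomogeneous k := hv.isHomogeneous k
  rcases Nat.lt_or_ge 1 k with hk | hk
  swap
  · exact Finset.sum_eq_zero fun i _ => hpk.pderiv_pderiv_eq_zero hk i
  obtain ⟨j, rfl⟩ : ∃ j, k = j + 2 := ⟨k - 2, by omega⟩
  set q := ∑ i, pderiv i (pderiv i p) with hq
  have hqj : q.IsHomogeneous j := IsHomogeneous.sum _ _ _ fun i _ => (hpk.pderiv (i := i)).pderiv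
  have hφ := isAveragingKernel_radialBump (n := n)
  have hm := hharm.hasMeanValue hs
  have hmp := hasMeanValue_leading hφ hv hV (hs.mem_nhds h0) hm
  have hmd := hm.sub hφ (hmp.mono (subset_univ s))
  obtain ⟨K, hK, hKest⟩ := HasMeanValue.norm_iteratedFDeriv_le hφ
  obtain ⟨C, hC, hest⟩ := hv.abs_sub_eval_le hV
  obtain ⟨δ, hδ, hball⟩ := Metric.mem_nhds_iff.1 (inter_mem (hs.mem_nhds h0) hest)
  refine MvPolynomial.funext fun x => ?_
  rw [map_zero]
  set N := ‖x‖ + 2 with hN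
  have hN0 : 0 < N := by positivity
  have key : ∀ ε : ℝ, 0 < ε → ε < δ / N → ‖eval x q‖ ≤ (n * (K ^ 2 * (C * N ^ (j + 3)))) * ε := by
    intro ε hε hεδ
    have hmem : ∀ z ∈ closedBall (ε • x) ((2 : ℕ) * ε),
        z ∈ ball (0 : Fin n → ℝ) δ ∧ ‖z‖ ≤ ε * N := by
      intro z hz
      have h1 : ‖z‖ ≤ ε * N := by
        have h2 := norm_le_norm_add_norm_sub' z (ε • x)
        rw [mem_closedBall, dist_eq_norm] at hz
        rw [norm_smul, Real.norm_of_nonneg hε.le] at h2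
        push_cast at hz
        rw [hN, mul_add]
        linarith
      refine ⟨?_, h1⟩
      rw [mem_ball_zero_iff]
      exact h1.trans_lt ((lt_div_iff₀ hN0).1 hεδ)
    have h2 := hKest 2 hs hmd hε (fun z hz => (hball (hmem z hz).1).1)
      (M := C * (ε * N) ^ (j + 3)) (fun z hz => by
        refine (hball (hmem z hz).1).2.trans ?_
        gcongr
        exact (hmem z hz).2)
    have hxs : ε • x ∈ s := (hball (hmem _ (mem_closedBall_self (by positivity))).1).1
    have hlap : eval (ε • x) q = - ∑ i, iteratedFDeriv ℝ 2 (fun y => v y - eval y p) (ε • x)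
        (fun _ => Pi.single i 1) := by
      have hsub : iteratedFDeriv ℝ 2 (fun y => v y - eval y p) (ε • x) =
          iteratedFDeriv ℝ 2 v (ε • x) - iteratedFDeriv ℝ 2 (fun y => eval y p) (ε • x) :=
        iteratedFDeriv_sub_apply (hharm.1.contDiffAt (hs.mem_nhds hxs))
          (contDiff_eval p).contDiffAt
      simp only [hsub, _root_.sub_apply, Finset.sum_sub_distrib, hharm.2 _ hxs,
        iteratedFDeriv_two_eval_single, zero_sub, neg_neg]
      rw [hq, map_sum]
    have h3 : ‖eval (ε • x) q‖ ≤ n * ((K / ε) ^ 2 * (C * (ε * N) ^ (j + 3))) := by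
      rw [hlap, norm_neg]
      refine (norm_sum_le_of_le _ (fun i _ => (ContinuousMultilinearMap.le_opNorm _ _).trans
        (?_ : _ ≤ (K / ε) ^ 2 * (C * (ε * N) ^ (j + 3))))).trans (by simp)
      simpa [Pi.norm_single] using h2
    rw [hqj.eval_smul, norm_mul, norm_pow, Real.norm_of_nonneg hε.le] at h3
    refine le_of_mul_le_mul_left (h3.trans (le_of_eq ?_)) (pow_pos hε j)
    rw [mul_pow ε N]
    field_simp
    ring
  have hlim : Tendsto (fun ε : ℝ => (n * (K ^ 2 * (C * N ^ (j + 3)))) * ε) (𝓝[>] 0) (𝓝 0) := by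
    have : Continuous fun ε : ℝ => (n * (K ^ 2 * (C * N ^ (j + 3)))) * ε := by fun_prop
    simpa using (this.tendsto 0).mono_left nhdsWithin_le_nhds
  have hle := ge_of_tendsto hlim (by
    filter_upwards [Ioo_mem_nhdsGT (div_pos hδ hN0)] with ε hε
    exact key ε hε.1 hε.2)
  exact norm_le_zero_iff.1 hle

end HasHomogeneousExpansion

end LeadingForm

section Assembly

open MvPolynomial Filter Topology Set

variable {n : ℕ} {Ω : Set (Fin n → ℝ)} {u v : (Fin n → ℝ) → ℝ}

/-- A harmonic function on a domain that is not identically zero vanishes on no open subset. -/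
lemma IsHarmonicOn.frequently_ne_zero (hv : IsHarmonicOn v Ω) (hΩ : IsOpen Ω)
    (hconn : IsPreconnected Ω) (hv0 : ¬ ∀ x ∈ Ω, v x = 0) {x : Fin n → ℝ} (hx : x ∈ Ω) :
    ∃ᶠ y in 𝓝 x, v y ≠ 0 := fun h =>
  hv0 <| AnalyticOnNhd.eqOn_zero_of_preconnected_of_eventuallyEq_zero
    (fun _ hz => hv.analyticAt hΩ hz) hconn hx (h.mono fun _ => not_not.1)

/-- Local divisibility by a harmonic function which is not locally zero. -/
lemma IsHarmonicOn.exists_analyticAt_eq_mul (hv : IsHarmonicOn v Ω) (hΩ : IsOpen Ω)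
    {x : Fin n → ℝ} (hx : x ∈ Ω) (hne : ∃ᶠ y in 𝓝 x, v y ≠ 0) (hu : AnalyticAt ℝ u x)
    (hZ : ∀ y ∈ Ω, v y = 0 → u y = 0) :
    ∃ f, AnalyticAt ℝ f x ∧ ∀ᶠ y in 𝓝 x, u y = v y * f y := by
  classical
  have hcont : Continuous fun y => x + y := by fun_prop
  have htend : Tendsto (fun y => x + y) (𝓝 0) (𝓝 x) := by simpa using hcont.tendsto 0
  have htend' : Tendsto (fun y => y - x) (𝓝 x) (𝓝 0) := by
    simpa using (show Continuous fun y => y - x by fun_prop).tendsto x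
  have hv' := hv.comp_add_left x
  have hs := hΩ.preimage hcont
  have h0 : (0 : Fin n → ℝ) ∈ (fun y => x + y) ⁻¹' Ω := by simpa using hx
  have hu' : AnalyticAt ℝ (fun y => u (x + y)) 0 :=
    AnalyticAt.fun_comp (by simpa using hu) (by fun_prop)
  obtain ⟨U, hU⟩ := hu'.exists_hasHomogeneousExpansion
  obtain ⟨V, hV⟩ := (hv'.analyticAt hs h0).exists_hasHomogeneousExpansion
  have hVne : ∃ k, PowerSeries.coeff k V ≠ 0 := by
    by_contra! hcon
    refine hne ?_
    filter_upwards [htend'.eventually hV.hasSum] with y hy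
    simp only [hcon, map_zero, add_sub_cancel] at hy
    exact not_not.2 (hy.unique hasSum_zero)
  have hlow : ∀ l < Nat.find hVne, PowerSeries.coeff l V = 0 := fun l hl =>
    not_not.1 (Nat.find_min hVne hl)
  obtain ⟨f, G, hf, hfeq⟩ := hU.exists_quotient hV hlow (Nat.find_spec hVne)
    (hV.laplacian_leading_eq_zero hlow hs h0 hv')
    ((hs.eventually_mem h0).mono fun y hy => (hv'.analyticAt hs hy).continuousAt)
    ((hs.eventually_mem h0).mono fun y hy => hZ (x + y) hy)
  refine ⟨fun y => f (y - x), AnalyticAt.fun_comp (by simpa using hf.analyticAt) (by fun_prop), ?_⟩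
  filter_upwards [htend'.eventually hfeq] with y hy
  simpa using hy

end Assembly

/-- Division theorem: if `u` is real analytic and `v` is harmonic on a domain
`Ω ⊆ ℝⁿ` (`n ≥ 2`), `v` not identically zero, and `Z(v) ⊆ Z(u)`, then there is a real
analytic `f` on `Ω` with `u = v·f`. -/
theorem stmt10 {n : ℕ} (hn : 2 ≤ n) (Ω : Set (Fin n → ℝ)) (hΩ : IsOpen Ω)
    (hconn : IsConnected Ω) (u v : (Fin n → ℝ) → ℝ)
    (hu : AnalyticOn ℝ u Ω) (hv : IsHarmonicOn v Ω)
    (hv0 : ¬ ∀ x ∈ Ω, v x = 0)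
    (hZ : ∀ x ∈ Ω, v x = 0 → u x = 0) :
    ∃ f : (Fin n → ℝ) → ℝ, AnalyticOn ℝ f Ω ∧ ∀ x ∈ Ω, u x = v x * f x := by
  have hne : ∀ x ∈ Ω, ∃ᶠ y in nhds x, v y ≠ 0 := fun x hx =>
    hv.frequently_ne_zero hΩ hconn.isPreconnected hv0 hx
  rw [hΩ.analyticOn_iff_analyticOnNhd] at hu
  choose! f hf hfeq using fun x hx =>
    hv.exists_analyticAt_eq_mul hΩ hx (hne x hx) (hu x hx) hZ
  refine ⟨fun x => f x x, AnalyticOnNhd.analyticOn fun x hx => ?_, fun x hx =>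
    (hfeq x hx).self_of_nhds⟩
  refine (hf x hx).congr ?_
  filter_upwards [hΩ.eventually_mem hx, (hf x hx).eventually_analyticAt,
    (hfeq x hx).eventually_nhds] with z hz hfz hfeqz
  by_contra hcon
  have hev := (hfz.continuousAt.prodMk (hf z hz).continuousAt).eventually
    (isOpen_ne_fun continuous_fst continuous_snd |>.mem_nhds hcon)
  obtain ⟨y, hy, hy1, hy2, hy3⟩ := ((hne z hz).and_eventually
    (hev.and (hfeqz.and (hfeq z hz)))).exists
  exact hy1 (mul_left_cancel₀ hy (hy2.symm.trans hy3))
end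

section
/- Let w be harmonic on Ω ⊆ ℝ^n and let Γ ⊂ Z(w) be a connected real analytic curve contained in the critical set of w. Define d(x) as the degree of the first non-zero homogeneous term of the Taylor expansion of w at x ∈ Γ. If there is a sequence of points x_i ∈ Γ converging to an interior point x_∞ of Γ with d(x_i) ≥ k for all i, then d(x) ≥ k for every x ∈ Γ. -/
open Filter Topology

section NewtonianKernel

open MeasureTheory Set Module Bornology

variable {ι : Type*} [Fintype ι]

lemma norm_sq_le_sum_sq (y : ι → ℝ) : ‖y‖ ^ 2 ≤ ∑ j, y j ^ 2 := by
  have h0 : 0 ≤ ∑ j, y j ^ 2 := Finset.sum_nonneg fun j _ => sq_nonneg _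
  have h : ‖y‖ ≤ √(∑ j, y j ^ 2) := by
    refine (pi_norm_le_iff_of_nonneg (Real.sqrt_nonneg _)).2 fun i => ?_
    rw [Real.norm_eq_abs]
    exact Real.abs_le_sqrt
      (Finset.single_le_sum (f := fun j => y j ^ 2) (fun j _ => sq_nonneg _) (Finset.mem_univ i))
  calc ‖y‖ ^ 2 ≤ √(∑ j, y j ^ 2) ^ 2 := by gcongr
    _ = _ := Real.sq_sqrt h0

/-- The regularized kernel `(s + |y|²)⁻ᵐ`. -/
noncomputable def regKernel (s : ℝ) (m : ℕ) (y : ι → ℝ) : ℝ := ((s + ∑ j, y j ^ 2) ^ m)⁻¹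

lemma add_sum_sq_pos {s : ℝ} (hs : 0 < s) (y : ι → ℝ) : 0 < s + ∑ j, y j ^ 2 := by positivity

lemma regKernel_pos {s : ℝ} (hs : 0 < s) (m : ℕ) (y : ι → ℝ) : 0 < regKernel s m y := by
  unfold regKernel; positivity

lemma continuous_regKernel {s : ℝ} (hs : 0 < s) (m : ℕ) :
    Continuous (regKernel (ι := ι) s m) := by
  unfold regKernel
  exact Continuous.inv₀ (by fun_prop) fun y => (pow_pos (add_sum_sq_pos hs y) m).ne'

lemma hasLineDerivAt_regKernel [DecidableEq ι] {s : ℝ} (hs : 0 < s) (m : ℕ) (i : ι) (y : ι → ℝ) :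
    HasLineDerivAt ℝ (regKernel s m) (-(2 * m * y i) * regKernel s (m + 1) y) y
      (Pi.single i 1) := by
  have hq : HasFDerivAt (fun y : ι → ℝ => s + ∑ j, y j ^ 2)
      (∑ j, (2 * y j) • ContinuousLinearMap.proj (R := ℝ) (φ := fun _ : ι => ℝ) j) y := by
    refine HasFDerivAt.const_add s (HasFDerivAt.fun_sum fun j _ => ?_)
    simpa using (hasFDerivAt_apply (𝕜 := ℝ) j y).pow 2
  have hpos := add_sum_sq_pos hs y
  have h := (hq.hasLineDerivAt (Pi.single i 1))
  have h2 := (HasDerivAt.pow h m).inv (by simpa using (pow_pos hpos m).ne')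
  unfold HasLineDerivAt regKernel
  convert! h2 using 1
  have : ∑ j, 2 * y j * (Pi.single i (1 : ℝ) : ι → ℝ) j = 2 * y i := by
    simp [Pi.single_apply]
  simp only [zero_smul, add_zero, FunLike.coe_sum, Finset.sum_apply,
    FunLike.coe_smul, Pi.smul_apply, ContinuousLinearMap.proj_apply, smul_eq_mul, this]
  rcases m with _ | m
  · simp
  · simp only [Pi.pow_apply, zero_smul, add_zero, Nat.add_sub_cancel]
    field_simp
    ring

lemma hasLineDerivAt_deriv_regKernel [DecidableEq ι] {s : ℝ} (hs : 0 < s) (m : ℕ) (i : ι)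
    (y : ι → ℝ) :
    HasLineDerivAt ℝ (fun y => -(2 * m * y i) * regKernel s (m + 1) y)
      (-(2 * m) * regKernel s (m + 1) y + 4 * m * (m + 1) * y i ^ 2 * regKernel s (m + 2) y) y
      (Pi.single i 1) := by
  have h1 : HasLineDerivAt ℝ (fun y : ι → ℝ => -(2 * m * y i)) (-(2 * m)) y (Pi.single i 1) := by
    have := ((hasFDerivAt_apply (𝕜 := ℝ) i y).const_mul (2 * (m : ℝ))).fun_neg
    simpa using this.hasLineDerivAt (Pi.single i 1)
  have h := HasDerivAt.mul h1 (hasLineDerivAt_regKernel hs (m + 1) i y)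
  unfold HasLineDerivAt
  convert! h using 1
  simp only [zero_smul, add_zero]
  push_cast
  ring

lemma integral_mul_iteratedFDeriv_two {E : Type*} [NormedAddCommGroup E] [NormedSpace ℝ E]
    [FiniteDimensional ℝ E] [MeasurableSpace E] [BorelSpace E] {μ : Measure E} [μ.IsAddHaarMeasure]
    {f f' f'' φ : E → ℝ} {v : E} (hf : Continuous f) (hf' : Continuous f') (hf'' : Continuous f'')
    (hff' : ∀ x, HasLineDerivAt ℝ f (f' x) x v) (hff'' : ∀ x, HasLineDerivAt ℝ f' (f'' x) x v)
    (hφ : ContDiff ℝ 2 φ) (hc : HasCompactSupport φ) :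
    ∫ x, f x * iteratedFDeriv ℝ 2 φ x (fun _ => v) ∂μ = ∫ x, f'' x * φ x ∂μ := by
  have parts : ∀ {a a' g : E → ℝ}, Continuous a → Continuous a' →
      (∀ x, HasLineDerivAt ℝ a (a' x) x v) → ContDiff ℝ 1 g → HasCompactSupport g →
      ∫ x, a x * fderiv ℝ g x v ∂μ = -∫ x, a' x * g x ∂μ := by
    intro a a' g ha ha' haa' hg hgc
    have hg' : Continuous fun x => fderiv ℝ g x v :=
      (hg.continuous_fderiv one_ne_zero).clm_apply continuous_const
    refine integral_bilinear_hasLineDerivAt_right_eq_neg_left_of_integrable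
      (B := ContinuousLinearMap.mul ℝ ℝ) ?_ ?_ ?_ (fun x _ => haa' x)
      (fun x _ => ((hg.differentiable one_ne_zero) x).hasFDerivAt.hasLineDerivAt v)
    · exact (ha'.mul hg.continuous).integrable_of_hasCompactSupport hgc.mul_left
    · exact (ha.mul hg').integrable_of_hasCompactSupport (hgc.fderiv_apply ℝ v).mul_left
    · exact (ha.mul hg.continuous).integrable_of_hasCompactSupport hgc.mul_left
  have hφ' : ContDiff ℝ 1 (fderiv ℝ φ) := hφ.fderiv_right (by norm_num)
  have hsecond : ∀ x, iteratedFDeriv ℝ 2 φ x (fun _ => v)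
      = fderiv ℝ (fun z => fderiv ℝ φ z v) x v := by
    intro x
    rw [iteratedFDeriv_two_apply, fderiv_clm_apply (hφ'.differentiable one_ne_zero x)
      (differentiableAt_const v)]
    simp
  simp_rw [hsecond]
  rw [parts hf hf' hff' (hφ'.clm_apply contDiff_const) (hc.fderiv_apply ℝ v),
    parts hf' hf'' hff'' (hφ.of_le (by norm_num)) hc, neg_neg]

/-- The Laplacian in the standard coordinates of `ι → ℝ`. -/
noncomputable def coordLaplacian [DecidableEq ι] (f : (ι → ℝ) → ℝ) (x : ι → ℝ) : ℝ :=
  ∑ i, iteratedFDeriv ℝ 2 f x (fun _ => Pi.single i 1)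

lemma continuous_coordLaplacian [DecidableEq ι] {φ : (ι → ℝ) → ℝ} (hφ : ContDiff ℝ 2 φ) :
    Continuous (coordLaplacian φ) := by
  unfold coordLaplacian
  have := hφ.continuous_iteratedFDeriv (m := 2) le_rfl
  fun_prop

lemma tsupport_coordLaplacian_subset [DecidableEq ι] (φ : (ι → ℝ) → ℝ) :
    tsupport (coordLaplacian φ) ⊆ tsupport φ := by
  refine closure_minimal (fun x hx => ?_) (isClosed_tsupport φ)
  by_contra hxn
  refine hx (Finset.sum_eq_zero fun i _ => ?_)
  have : iteratedFDeriv ℝ 2 φ x = 0 := by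
    by_contra h
    exact hxn (support_iteratedFDeriv_subset 2 h)
  simp [this]

lemma integral_regKernel_mul_coordLaplacian [DecidableEq ι] {s : ℝ} (hs : 0 < s) {m : ℕ}
    (hι : Fintype.card ι = 2 * m + 2) {φ : (ι → ℝ) → ℝ} (hφ : ContDiff ℝ 2 φ)
    (hc : HasCompactSupport φ) :
    ∫ y, regKernel s m y * coordLaplacian φ y
      = -(4 * m * (m + 1)) * ∫ y, s * regKernel s (m + 2) y * φ y := by
  have hk := continuous_regKernel (ι := ι) hs m
  have hk₁ := continuous_regKernel (ι := ι) hs (m + 1)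
  have hk₂ := continuous_regKernel (ι := ι) hs (m + 2)
  have hD : Continuous (iteratedFDeriv ℝ 2 φ) := hφ.continuous_iteratedFDeriv (m := 2) le_rfl
  have hDc : ∀ v : ι → ℝ, HasCompactSupport fun y => iteratedFDeriv ℝ 2 φ y (fun _ => v) :=
    fun v => (hc.iteratedFDeriv (𝕜 := ℝ) 2).comp_left
      (g := fun L : ContinuousMultilinearMap ℝ (fun _ : Fin 2 => ι → ℝ) ℝ => L fun _ => v) rfl
  unfold coordLaplacian
  simp_rw [Finset.mul_sum]
  rw [integral_finsetSum]
  swap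
  · intro i _
    exact Continuous.integrable_of_hasCompactSupport (by fun_prop) (hDc _).mul_left
  have hstep : ∀ i : ι, ∫ y, regKernel s m y * iteratedFDeriv ℝ 2 φ y (fun _ => Pi.single i 1)
      = ∫ y, (-(2 * m) * regKernel s (m + 1) y
          + 4 * m * (m + 1) * y i ^ 2 * regKernel s (m + 2) y) * φ y := fun i =>
    integral_mul_iteratedFDeriv_two hk (by fun_prop) (by fun_prop)
      (hasLineDerivAt_regKernel hs m i) (hasLineDerivAt_deriv_regKernel hs m i) hφ hc
  have hφc := hφ.continuous
  rw [Finset.sum_congr rfl fun i _ => hstep i, ← integral_finsetSum, ← integral_const_mul]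
  swap
  · intro i _
    exact Continuous.integrable_of_hasCompactSupport (by fun_prop) hc.mul_left
  congr 1 with y
  rw [← Finset.sum_mul, Finset.sum_add_distrib, ← Finset.sum_mul, ← Finset.sum_mul, ← Finset.mul_sum,
    Finset.sum_const, Finset.card_univ, hι]
  have hrec : regKernel s (m + 1) y = (s + ∑ j, y j ^ 2) * regKernel s (m + 2) y := by
    have := (add_sum_sq_pos hs y).ne'
    unfold regKernel
    field_simp
    ring
  rw [hrec]
  simp only [nsmul_eq_mul]
  push_cast
  ring

lemma regKernel_one_le (m : ℕ) (y : ι → ℝ) : regKernel 1 m y ≤ ((1 + ‖y‖ ^ 2) ^ m)⁻¹ := by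
  unfold regKernel
  have := norm_sq_le_sum_sq y
  gcongr

lemma integrable_regKernel_one {m : ℕ} (hι : Fintype.card ι = 2 * m + 2) :
    Integrable (regKernel (ι := ι) 1 (m + 2)) := by
  have h : Integrable fun y : ι → ℝ => (1 + ‖y‖ ^ 2) ^ (-(2 * m + 4 : ℝ) / 2) := by
    refine integrable_rpow_neg_one_add_norm_sq ?_
    rw [finrank_fintype_fun_eq_card, hι]
    push_cast
    linarith
  refine h.mono' (continuous_regKernel one_pos _).aestronglyMeasurable (.of_forall fun y => ?_)
  rw [Real.norm_of_nonneg (regKernel_pos one_pos _ y).le]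
  refine (regKernel_one_le _ y).trans_eq ?_
  rw [show -(2 * m + 4 : ℝ) / 2 = -((m + 2 : ℕ) : ℝ) by push_cast; ring,
    Real.rpow_neg (by positivity), Real.rpow_natCast]

lemma integral_regKernel_one_pos {m : ℕ} (hι : Fintype.card ι = 2 * m + 2) :
    0 < ∫ y : ι → ℝ, regKernel 1 (m + 2) y := by
  have hsupp : Function.support (regKernel (ι := ι) 1 (m + 2)) = univ :=
    Set.eq_univ_of_forall fun y => (regKernel_pos one_pos _ y).ne'
  rw [integral_pos_iff_support_of_nonneg (fun y => (regKernel_pos one_pos _ y).le)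
    (integrable_regKernel_one hι), hsupp]
  exact isOpen_univ.measure_pos _ univ_nonempty

lemma tendsto_norm_pow_mul_regKernel_one (m : ℕ) :
    Tendsto (fun y : ι → ℝ => ‖y‖ ^ (2 * m + 2) * regKernel 1 (m + 2) y)
      (cobounded (ι → ℝ)) (𝓝 0) := by
  have hlim : Tendsto (fun y : ι → ℝ => (1 + ‖y‖ ^ 2)⁻¹) (cobounded (ι → ℝ)) (𝓝 0) :=
    tendsto_inv_atTop_zero.comp (tendsto_atTop_add_const_left _ _
      ((tendsto_pow_atTop two_ne_zero).comp tendsto_norm_cobounded_atTop))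
  refine squeeze_zero (fun y => mul_nonneg (by positivity) (regKernel_pos one_pos _ y).le)
    (fun y => ?_) hlim
  calc ‖y‖ ^ (2 * m + 2) * regKernel 1 (m + 2) y
      ≤ (1 + ‖y‖ ^ 2) ^ (m + 1) * ((1 + ‖y‖ ^ 2) ^ (m + 2))⁻¹ := by
        refine mul_le_mul ?_ (regKernel_one_le _ y) (regKernel_pos one_pos _ y).le (by positivity)
        rw [show 2 * m + 2 = 2 * (m + 1) by ring, pow_mul]
        gcongr
        linarith
    _ = (1 + ‖y‖ ^ 2)⁻¹ := by
        field_simp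
        ring

lemma regKernel_scaling {c : ℝ} (hc : 0 < c) (m : ℕ) (y : ι → ℝ) :
    (c ^ 2)⁻¹ * regKernel (c ^ 2)⁻¹ (m + 2) y
      = c ^ (2 * m + 2) * regKernel 1 (m + 2) (c • y) := by
  have h : 1 + ∑ j, (c • y) j ^ 2 = c ^ 2 * ((c ^ 2)⁻¹ + ∑ j, y j ^ 2) := by
    rw [mul_add, mul_inv_cancel₀ (by positivity), Finset.mul_sum]
    simp [mul_pow]
  have hpos : 0 < (c ^ 2)⁻¹ + ∑ j, y j ^ 2 := add_sum_sq_pos (by positivity) y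
  unfold regKernel
  rw [h, mul_pow]
  generalize (c ^ 2)⁻¹ + ∑ j, y j ^ 2 = a at hpos
  field_simp
  ring

lemma tendsto_integral_regKernel_mul {m : ℕ} (hι : Fintype.card ι = 2 * m + 2)
    {φ : (ι → ℝ) → ℝ} (hφ : Continuous φ) (hc : HasCompactSupport φ) :
    Tendsto (fun c : ℝ => ∫ y, (c ^ 2)⁻¹ * regKernel (c ^ 2)⁻¹ (m + 2) y * φ y) atTop
      (𝓝 ((∫ y : ι → ℝ, regKernel 1 (m + 2) y) * φ 0)) := by
  set J := ∫ y : ι → ℝ, regKernel 1 (m + 2) y with hJ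
  have hJpos : 0 < J := integral_regKernel_one_pos hι
  have hdim : finrank ℝ (ι → ℝ) = 2 * m + 2 := by rw [finrank_fintype_fun_eq_card, hι]
  have key := tendsto_integral_comp_smul_smul_of_integrable (μ := (volume : Measure (ι → ℝ)))
    (φ := fun y => J⁻¹ * regKernel 1 (m + 2) y)
    (fun y => mul_nonneg (by positivity) (regKernel_pos one_pos _ y).le)
    (by rw [integral_const_mul, ← hJ, inv_mul_cancel₀ hJpos.ne'])
    (by
      rw [hdim]
      simpa [mul_left_comm] using (tendsto_norm_pow_mul_regKernel_one (ι := ι) m).const_mul J⁻¹)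
    (hφ.integrable_of_hasCompactSupport hc) hφ.continuousAt
  refine (key.const_mul J).congr' ?_
  filter_upwards [eventually_gt_atTop 0] with c hcpos
  rw [← integral_const_mul]
  congr 1 with y
  rw [regKernel_scaling hcpos, hdim, smul_eq_mul]
  field_simp

lemma tendsto_integral_regKernel_mul_of_eventually_zero (m : ℕ) {f : (ι → ℝ) → ℝ}
    (hf : Continuous f) (hc : HasCompactSupport f) (h0 : ∀ᶠ y in 𝓝 0, f y = 0) :
    Tendsto (fun c : ℝ => ∫ y, regKernel (c ^ 2)⁻¹ m y * f y) atTop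
      (𝓝 (∫ y, regKernel 0 m y * f y)) := by
  obtain ⟨r, hr, hball⟩ := Metric.eventually_nhds_iff.1 h0
  have hfar : ∀ y, f y ≠ 0 → r ^ 2 ≤ ∑ j, y j ^ 2 := by
    intro y hy
    have : r ≤ ‖y‖ := by
      by_contra! h
      exact hy (hball (by simpa using h))
    exact (pow_le_pow_left₀ hr.le this 2).trans (norm_sq_le_sum_sq y)
  refine tendsto_integral_filter_of_dominated_convergence (fun y => ((r ^ 2) ^ m)⁻¹ * ‖f y‖)
    ?_ ?_ ((hf.integrable_of_hasCompactSupport hc).norm.const_mul _) (.of_forall fun y => ?_)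
  · filter_upwards [eventually_gt_atTop 0] with c hcpos
    exact ((continuous_regKernel (by positivity) m).mul hf).aestronglyMeasurable
  · filter_upwards [eventually_gt_atTop 0] with c hcpos
    refine .of_forall fun y => ?_
    rw [norm_mul, Real.norm_of_nonneg (regKernel_pos (by positivity) m y).le]
    rcases eq_or_ne (f y) 0 with hy | hy
    · simp [hy]
    · have := hfar y hy
      have h2 : 0 < (c ^ 2)⁻¹ := by positivity
      unfold regKernel
      gcongr
      linarith
  · rcases eq_or_ne (f y) 0 with hy | hy
    · simp [hy]
    · have hpos : 0 < ∑ j, y j ^ 2 := (by positivity : 0 < r ^ 2).trans_le (hfar y hy)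
      have hs : Tendsto (fun c : ℝ => (c ^ 2)⁻¹) atTop (𝓝 0) :=
        tendsto_inv_atTop_zero.comp (tendsto_pow_atTop two_ne_zero)
      unfold regKernel
      exact (((hs.add_const _).pow m).inv₀ (by simpa using (pow_pos hpos m).ne')).mul_const _

/-- Green's representation at the origin, for test functions harmonic near the origin. -/
lemma integral_newtonian_mul_coordLaplacian [DecidableEq ι] {m : ℕ}
    (hι : Fintype.card ι = 2 * m + 2) {φ : (ι → ℝ) → ℝ} (hφ : ContDiff ℝ 2 φ)
    (hc : HasCompactSupport φ) (h0 : ∀ᶠ y in 𝓝 0, coordLaplacian φ y = 0) :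
    ∫ y, regKernel 0 m y * coordLaplacian φ y
      = -(4 * m * (m + 1)) * (∫ y : ι → ℝ, regKernel 1 (m + 2) y) * φ 0 := by
  have hlap : HasCompactSupport (coordLaplacian φ) :=
    hc.of_isClosed_subset (isClosed_tsupport _) (tsupport_coordLaplacian_subset φ)
  refine tendsto_nhds_unique (tendsto_integral_regKernel_mul_of_eventually_zero m
    (continuous_coordLaplacian hφ) hlap h0) ?_
  rw [mul_assoc]
  refine ((tendsto_integral_regKernel_mul hι hφ.continuous hc).const_mul _).congr' ?_
  filter_upwards [eventually_gt_atTop 0] with c hcpos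
  rw [integral_regKernel_mul_coordLaplacian (by positivity) hι hφ hc]

lemma analyticAt_inverse_sum_sq_pow {𝔸 : Type*} [NormedCommRing 𝔸] [NormedAlgebra ℝ 𝔸]
    [CompleteSpace 𝔸] (Y : ι → 𝔸) (m : ℕ) {x₀ : ι → ℝ}
    (hunit : IsUnit (∑ j, (Y j - x₀ j • (1 : 𝔸)) ^ 2)) :
    AnalyticAt ℝ (fun x : ι → ℝ => Ring.inverse (∑ j, (Y j - x j • (1 : 𝔸)) ^ 2) ^ m) x₀ := by
  have hsum : AnalyticAt ℝ (fun x : ι → ℝ => ∑ j, (Y j - x j • (1 : 𝔸)) ^ 2) x₀ := by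
    refine Finset.analyticAt_fun_sum _ fun j _ => ?_
    have hj : AnalyticAt ℝ (fun x : ι → ℝ => x j • (1 : 𝔸)) x₀ :=
      ((ContinuousLinearMap.proj (R := ℝ) (φ := fun _ : ι => ℝ) j).smulRight (1 : 𝔸)).analyticAt x₀
    exact (analyticAt_const.sub hj).pow 2
  obtain ⟨z, hz⟩ := hunit
  have hinv : AnalyticAt ℝ Ring.inverse (∑ j, (Y j - x₀ j • (1 : 𝔸)) ^ 2) :=
    hz ▸ analyticAt_inverse (𝕜 := ℝ) z
  exact (hinv.comp_of_eq hsum rfl).pow m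

lemma analyticAt_integral_newtonian (m : ℕ) {f : (ι → ℝ) → ℝ} (hf : Continuous f)
    {A : Set (ι → ℝ)} (hA : IsCompact A) (hfA : ∀ y ∉ A, f y = 0) {x₀ : ι → ℝ} (hx₀ : x₀ ∉ A) :
    AnalyticAt ℝ (fun x => ∫ y, regKernel 0 m (y - x) * f y) x₀ := by
  have : CompactSpace A := isCompact_iff_compactSpace.1 hA
  let ν : Measure A := volume.comap Subtype.val
  have : IsFiniteMeasure ν := by
    refine ⟨?_⟩
    rw [comap_subtype_coe_apply hA.measurableSet]
    simpa using hA.measure_lt_top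
  have hint : ∀ g : C(A, ℝ), Integrable (fun a : A => g a * f a) ν := fun g =>
    (g.continuous.mul (hf.comp continuous_subtype_val)).integrable_of_hasCompactSupport
      (HasCompactSupport.of_compactSpace _)
  let L₀ : C(A, ℝ) →ₗ[ℝ] ℝ :=
    { toFun := fun g => ∫ a : A, g a * f a ∂ν
      map_add' := fun g h => by
        simp only [ContinuousMap.add_apply, add_mul]
        exact integral_add (hint g) (hint h)
      map_smul' := fun c g => by
        simp only [ContinuousMap.smul_apply, smul_eq_mul, mul_assoc, RingHom.id_apply]
        exact integral_const_mul c _ }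
  let L : C(A, ℝ) →L[ℝ] ℝ := L₀.mkContinuous (∫ a : A, ‖f a‖ ∂ν) fun g => by
    rw [mul_comm, ← integral_const_mul]
    refine norm_integral_le_of_norm_le (((by simpa using hint 1 :
      Integrable (fun a : A => f a) ν)).norm.const_mul _) (.of_forall fun a => ?_)
    rw [norm_mul]
    gcongr
    exact g.norm_coe_le_norm a
  let Y : ι → C(A, ℝ) := fun j => ⟨fun a => a.1 j, (continuous_apply j).comp continuous_subtype_val⟩
  let Q : (ι → ℝ) → C(A, ℝ) := fun x => ∑ j, (Y j - x j • (1 : C(A, ℝ))) ^ 2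
  have hQ : ∀ x a, Q x a = ∑ j, (a.1 - x) j ^ 2 := by
    intro x a
    simp [Q, Y, ContinuousMap.sum_apply]
  have hQunit : ∀ x ∉ A, IsUnit (Q x) := by
    intro x hx
    rw [ContinuousMap.isUnit_iff_forall_ne_zero]
    intro a
    rw [hQ]
    have hne : 0 < ‖a.1 - x‖ := norm_pos_iff.2 (sub_ne_zero.2 fun h => hx (h ▸ a.2))
    exact ((by positivity : 0 < ‖a.1 - x‖ ^ 2).trans_le (norm_sq_le_sum_sq _)).ne'
  have hinv : AnalyticAt ℝ (fun x => Ring.inverse (Q x) ^ m) x₀ :=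
    analyticAt_inverse_sum_sq_pow Y m (hQunit x₀ hx₀)
  refine ((L.analyticAt _).comp hinv).congr ?_
  filter_upwards [hA.isClosed.isOpen_compl.mem_nhds hx₀] with x hx
  have heval : ∀ a : A, (Ring.inverse (Q x) ^ m) a = regKernel 0 m (a.1 - x) := by
    intro a
    have h1 : (Q x * Ring.inverse (Q x)) a = 1 := by
      rw [Ring.mul_inverse_cancel _ (hQunit x hx)]; rfl
    rw [ContinuousMap.mul_apply, hQ] at h1
    rw [ContinuousMap.pow_apply, eq_inv_of_mul_eq_one_right h1, regKernel, zero_add, inv_pow]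
  calc L (Ring.inverse (Q x) ^ m) = ∫ a : A, regKernel 0 m (a.1 - x) * f a ∂ν :=
        integral_congr_ae (.of_forall fun a => by simp only [heval])
    _ = ∫ y in A, regKernel 0 m (y - x) * f y :=
        integral_subtype_comap hA.measurableSet fun y => regKernel 0 m (y - x) * f y
    _ = _ := setIntegral_eq_integral_of_forall_compl_eq_zero fun y hy => by rw [hfA y hy, mul_zero]

lemma coordLaplacian_comp_add_right [DecidableEq ι] (φ : (ι → ℝ) → ℝ) (x y : ι → ℝ) :
    coordLaplacian (fun z => φ (z + x)) y = coordLaplacian φ (y + x) := by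
  unfold coordLaplacian
  rw [iteratedFDeriv_comp_add_right]

lemma Filter.EventuallyEq.coordLaplacian_eq [DecidableEq ι] {f g : (ι → ℝ) → ℝ} {x : ι → ℝ}
    (h : f =ᶠ[𝓝 x] g) : coordLaplacian f x = coordLaplacian g x := by
  unfold coordLaplacian
  rw [(h.iteratedFDeriv ℝ 2).eq_of_nhds]

/-- Harmonic functions in even dimension at least four are real analytic. -/
lemma analyticAt_of_coordLaplacian_eq_zero [DecidableEq ι] {m : ℕ} (hm : m ≠ 0)
    (hι : Fintype.card ι = 2 * m + 2) {U : Set (ι → ℝ)} (hU : IsOpen U) {u : (ι → ℝ) → ℝ}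
    (hu : ContDiffOn ℝ 2 u U) (hlap : ∀ x ∈ U, coordLaplacian u x = 0) {x₀ : ι → ℝ}
    (hx₀ : x₀ ∈ U) : AnalyticAt ℝ u x₀ := by
  obtain ⟨R, hR, hRU⟩ := Metric.nhds_basis_closedBall.mem_iff.1 (hU.mem_nhds hx₀)
  let χ : ContDiffBump x₀ := ⟨R / 2, R, by positivity, by linarith⟩
  let φ : (ι → ℝ) → ℝ := fun y => χ y * u y
  have hsupp : tsupport φ ⊆ Metric.closedBall x₀ R :=
    (tsupport_mul_subset_left (f := χ) (g := u)).trans χ.tsupport_eq.subset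
  have hφc : HasCompactSupport φ := χ.hasCompactSupport.mul_right
  have hφ : ContDiff ℝ 2 φ := by
    refine contDiff_iff_contDiffAt.2 fun x => ?_
    by_cases hx : x ∈ tsupport φ
    swap
    · exact contDiffAt_const.congr_of_eventuallyEq (notMem_tsupport_iff_eventuallyEq.1 hx)
    exact χ.contDiff.contDiffAt.mul (hu.contDiffAt (hU.mem_nhds (hRU (hsupp hx))))
  have hball : ∀ x ∈ Metric.ball x₀ (R / 2), φ =ᶠ[𝓝 x] u := by
    intro x hx
    filter_upwards [Metric.isOpen_ball.mem_nhds hx] with y hy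
    simp [φ, χ.one_of_mem_closedBall (Metric.ball_subset_closedBall hy)]
  have hlapφ : ∀ x ∈ Metric.ball x₀ (R / 2), coordLaplacian φ x = 0 := by
    intro x hx
    rw [(hball x hx).coordLaplacian_eq]
    exact hlap x (hRU (Metric.ball_subset_closedBall (Metric.ball_subset_ball (by linarith) hx)))
  set A : Set (ι → ℝ) := Metric.closedBall x₀ R \ Metric.ball x₀ (R / 2)
  have hA : IsCompact A := (isCompact_closedBall x₀ R).diff Metric.isOpen_ball
  have hzero : ∀ y ∉ A, coordLaplacian φ y = 0 := by
    intro y hy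
    by_contra hne
    exact hy ⟨hsupp (tsupport_coordLaplacian_subset φ (subset_closure hne)),
      fun hb => hne (hlapφ y hb)⟩
  have hx₀b : x₀ ∈ Metric.ball x₀ (R / 2) := Metric.mem_ball_self (by positivity)
  set C : ℝ := -(4 * m * (m + 1)) * ∫ y : ι → ℝ, regKernel 1 (m + 2) y
  have hC : C ≠ 0 := by
    have := (integral_regKernel_one_pos hι).ne'
    have hm' : (m : ℝ) ≠ 0 := Nat.cast_ne_zero.2 hm
    exact mul_ne_zero (neg_ne_zero.2 (by positivity)) this
  refine (analyticAt_const (v := C⁻¹) |>.fun_mul (analyticAt_integral_newtonian m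
    (continuous_coordLaplacian hφ) hA hzero (fun h => h.2 hx₀b))).congr ?_
  filter_upwards [Metric.isOpen_ball.mem_nhds hx₀b] with x hx
  have hshift : ContDiff ℝ 2 fun z => φ (z + x) := hφ.comp (contDiff_id.add contDiff_const)
  have h := integral_newtonian_mul_coordLaplacian hι hshift
    (hφc.comp_homeomorph (Homeomorph.addRight x)) (by
      have ht : Tendsto (fun y => y + x) (𝓝 0) (𝓝 x) := by
        simpa using (continuous_id.add continuous_const).tendsto (0 : ι → ℝ) (f := fun y => y + x)
      filter_upwards [ht.eventually (Metric.isOpen_ball.mem_nhds hx)] with y hy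
      rw [coordLaplacian_comp_add_right, hlapφ _ hy])
  have htrans := integral_add_right_eq_self (μ := (volume : Measure (ι → ℝ)))
    (fun y => regKernel 0 m (y - x) * coordLaplacian φ y) x
  simp only [add_sub_cancel_right] at htrans
  simp only [coordLaplacian_comp_add_right, zero_add] at h
  rw [← htrans, h, (hball x hx).eq_of_nhds, inv_mul_cancel_left₀ hC]

end NewtonianKernel

/-- Harmonic functions are real analytic. Adding dummy variables reduces to the case where the
Newtonian kernel is an integral power of the squared distance. -/
theorem IsHarmonicOn.analyticOnNhd {n : ℕ} {f : (Fin n → ℝ) → ℝ} {s : Set (Fin n → ℝ)}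
    (hf : IsHarmonicOn f s) (hs : IsOpen s) : AnalyticOnNhd ℝ f s := by
  intro x hx
  let ι := Fin n ⊕ Fin (n + 4)
  let P : (ι → ℝ) →L[ℝ] (Fin n → ℝ) :=
    ContinuousLinearMap.pi fun i => ContinuousLinearMap.proj (Sum.inl i)
  let S : (Fin n → ℝ) →L[ℝ] (ι → ℝ) := ContinuousLinearMap.pi
    (Sum.elim (fun i => ContinuousLinearMap.proj i) fun _ => 0)
  have hPS : ∀ z, P (S z) = z := fun z => by ext i; simp [P, S]
  have hopen : IsOpen (P ⁻¹' s) := hs.preimage P.continuous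
  have hPl : ∀ i, P (Pi.single (Sum.inl i) 1) = Pi.single i 1 := by
    intro i; ext j; simp [P, Pi.single_apply, Sum.inl_injective.eq_iff]
  have hPr : ∀ i, P (Pi.single (Sum.inr i) 1) = 0 := by
    intro i; ext j; simp [P]
  have hlap : ∀ z ∈ P ⁻¹' s, coordLaplacian (f ∘ P) z = 0 := by
    intro z hz
    have hD : iteratedFDeriv ℝ 2 (f ∘ P) z
        = (iteratedFDeriv ℝ 2 f (P z)).compContinuousLinearMap fun _ => P := by
      rw [← iteratedFDerivWithin_of_isOpen 2 hopen hz, ← iteratedFDerivWithin_of_isOpen 2 hs hz]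
      exact P.iteratedFDerivWithin_comp_right hf.1 hs.uniqueDiffOn hopen.uniqueDiffOn hz le_rfl
    have hzero : iteratedFDeriv ℝ 2 f (P z) (fun _ => 0) = 0 :=
      ContinuousMultilinearMap.map_coord_zero _ 0 rfl
    simp only [coordLaplacian, hD, ContinuousMultilinearMap.compContinuousLinearMap_apply]
    rw [Fintype.sum_sum_type]
    simp only [hPl, hPr, hzero, Finset.sum_const_zero, add_zero]
    exact hf.2 _ hz
  have hSx : S x ∈ P ⁻¹' s := by simpa [hPS] using hx
  have han : AnalyticAt ℝ (f ∘ P) (S x) :=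
    analyticAt_of_coordLaplacian_eq_zero (m := n + 1) n.succ_ne_zero
      (by simp [ι]; ring) hopen (hf.1.comp P.contDiff.contDiffOn (Set.mapsTo_preimage P s))
      hlap hSx
  refine (han.comp (S.analyticAt x)).congr (.of_forall fun z => ?_)
  simp [hPS]

/-- Constancy of the vanishing order along an analytic curve in the critical set: if
`w` is harmonic on `Ω`, `γ` is a real analytic curve (parametrized on an interval `I`)
lying in the critical set of `w`, and there are parameters `tᵢ ≠ t∗`, `tᵢ → t∗ ∈ I`,
at which all partial derivatives of `w` of order `< k` vanish, then all partial
derivatives of `w` of order `< k` vanish at every point of the curve. -/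
theorem stmt15 {n : ℕ} (Ω : Set (Fin n → ℝ)) (hΩ : IsOpen Ω)
    (w : (Fin n → ℝ) → ℝ) (hw : IsHarmonicOn w Ω)
    (I : Set ℝ) (hI : IsOpen I) (hIconn : IsConnected I)
    (γ : ℝ → (Fin n → ℝ)) (hγ : AnalyticOn ℝ γ I)
    (hγΩ : ∀ t ∈ I, γ t ∈ Ω)
    (hcrit : ∀ t ∈ I, w (γ t) = 0 ∧ fderiv ℝ w (γ t) = 0)
    (k : ℕ) (t : ℕ → ℝ) (tL : ℝ) (ht : ∀ i, t i ∈ I) (htL : tL ∈ I)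
    (htne : ∀ i, t i ≠ tL) (hlim : Tendsto t atTop (𝓝 tL))
    (hd : ∀ i : ℕ, ∀ m : ℕ, m < k → iteratedFDeriv ℝ m w (γ (t i)) = 0) :
    ∀ s ∈ I, ∀ m : ℕ, m < k → iteratedFDeriv ℝ m w (γ s) = 0 := by
  intro s hs m hm
  have hγ' : AnalyticOnNhd ℝ γ I := hI.analyticOn_iff_analyticOnNhd.1 hγ
  have han : AnalyticOnNhd ℝ (fun s => iteratedFDeriv ℝ m w (γ s)) I :=
    ((hw.analyticOnNhd hΩ).iteratedFDeriv m).comp hγ' hγΩ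
  refine han.eqOn_zero_of_preconnected_of_frequently_eq_zero hIconn.isPreconnected htL ?_ hs
  have ht' : Tendsto t atTop (𝓝[≠] tL) :=
    tendsto_nhdsWithin_of_tendsto_nhds_of_eventually_within _ hlim (.of_forall htne)
  exact ht'.frequently (.of_forall fun i => hd i m hm)
end
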